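/- arXiv:1602.02461 — 2 statements merged into one kernel-verified Lean document; each statement's English description precedes it below -/
import Mathlib

section
/- Let k ≥ 2 be an integer and G a planar finite simple graph. If |H_k(G)| − |L_k(G)| ≥ 2k, then G contains k pairwise vertex-disjoint cycles. -/
open Finset unitInterval

/-- `G` contains `k` pairwise vertex-disjoint cycles. -/
def HasDisjointCycles {V : Type*} (G : SimpleGraph V) (k : ℕ) : Prop :=
  ∃ (v : Fin k → V) (c : ∀ i, G.Walk (v i) (v i)),
    (∀ i, (c i).IsCycle) ∧
    ∀ i j, i ≠ j → ∀ x, x ∈ (c i).support → x ∉ (c j).support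

/-- `H_k(G)`: the set of vertices of degree at least `2k`. -/
def Hset {V : Type*} [Fintype V] (G : SimpleGraph V) [DecidableRel G.Adj] (k : ℕ) : Finset V :=
  univ.filter fun v => 2 * k ≤ G.degree v

/-- `L_k(G)`: the set of vertices of degree at most `2k - 2`. -/
def Lset {V : Type*} [Fintype V] (G : SimpleGraph V) [DecidableRel G.Adj] (k : ℕ) : Finset V :=
  univ.filter fun v => G.degree v ≤ 2 * k - 2


/-- A drawing of `G` in the plane: vertices go to distinct points, each edge is drawn as a
simple continuous arc between the images of its endpoints, arcs of an edge in its two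
orientations coincide (up to reversal of the parametrization), the interior of an arc avoids
all vertex points, and interiors of arcs of distinct edges do not meet. -/
def IsPlanar {V : Type*} (G : SimpleGraph V) : Prop :=
  ∃ (f : V → ℝ × ℝ) (arc : ∀ u v : V, G.Adj u v → (I → ℝ × ℝ)),
    Function.Injective f ∧
    (∀ u v (h : G.Adj u v), Continuous (arc u v h)) ∧
    (∀ u v (h : G.Adj u v), Function.Injective (arc u v h)) ∧
    (∀ u v (h : G.Adj u v), arc u v h 0 = f u ∧ arc u v h 1 = f v) ∧
    (∀ u v (h : G.Adj u v) (t : I), arc u v h t = arc v u h.symm (symm t)) ∧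
    (∀ u v (h : G.Adj u v) (t : I), t ≠ 0 → t ≠ 1 → ∀ w : V, arc u v h t ≠ f w) ∧
    (∀ u v (h : G.Adj u v) (u' v' : V) (h' : G.Adj u' v'), s(u, v) ≠ s(u', v') →
      ∀ t t' : I, t ≠ 0 → t ≠ 1 → arc u v h t ≠ arc u' v' h' t')

section Topology

open Complex in
/-- A continuous nonvanishing complex function on the square has a continuous logarithm. -/
lemma exists_continuous_log {g : I × I → ℂ} (hg : Continuous g) (h0 : ∀ p, g p ≠ 0) :
    ∃ Θ : I × I → ℂ, Continuous Θ ∧ ∀ p, exp (Θ p) = g p := by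
  let pr : ℝ × ℝ → I × I := fun q =>
    (Set.projIcc 0 1 zero_le_one q.1, Set.projIcc 0 1 zero_le_one q.2)
  have hpr : Continuous pr := by
    refine Continuous.prodMk ?_ ?_
    · exact continuous_projIcc.comp continuous_fst
    · exact continuous_projIcc.comp continuous_snd
  obtain ⟨F, ⟨-, hF⟩, -⟩ := isCoveringMapOn_exp.existsUnique_continuousMap_lifts
    (A := ℝ × ℝ) ⟨g ∘ pr, hg.comp hpr⟩ (a₀ := 0) (e₀ := log (g (pr 0)))
    (by simp [exp_log (h0 _)]) (by intro a; simpa using h0 _)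
  refine ⟨fun p => F (p.1, p.2), by fun_prop, fun p => ?_⟩
  have := congrFun hF ((p.1 : ℝ), (p.2 : ℝ))
  simpa [pr] using this

open Complex in
/-- Two continuous logarithms of the same path have the same increment. -/
lemma log_increment_unique {θ θ' : I → ℂ} (hθ : Continuous θ) (hθ' : Continuous θ')
    (h : ∀ t, exp (θ t) = exp (θ' t)) : θ 1 - θ 0 = θ' 1 - θ' 0 := by
  have h0 : exp (θ 0 - θ' 0) = 1 := by
    rw [exp_sub, h 0, div_self (exp_ne_zero _)]
  have key : θ = fun t => θ' t + (θ 0 - θ' 0) := by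
    refine isCoveringMap_exp.eq_of_comp_eq hθ (by fun_prop) ?_ 0 (by ring)
    funext t
    simp [exp_add, h0, h t]
  have : θ 1 = θ' 1 + (θ 0 - θ' 0) := congrFun key 1
  rw [this]; ring

/-- A parity obstruction to planarity: `o` compares ordered pairs of vertices, `n u v w` counts
modulo two how the edge `uv` winds around the vertex `w`, and for disjoint edges the counts are
determined by `o`. -/
def ParityPlanar {V : Type*} (G : SimpleGraph V) (S : Finset V) : Prop :=
  ∃ (o : V → V → ZMod 2) (n : V → V → V → ZMod 2),
    (∀ u w, u ≠ w → o u w + o w u = 1) ∧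
    ∀ a ∈ S, ∀ b ∈ S, ∀ c ∈ S, ∀ d ∈ S, G.Adj a b → G.Adj c d →
      a ≠ c → a ≠ d → b ≠ c → b ≠ d →
      n a b c + n a b d + n c d a + n c d b = o a c + o a d + o b c + o b d

open Complex in
lemma parityPlanar_of_isPlanar {V : Type*} {G : SimpleGraph V} (h : IsPlanar G) (S : Finset V) :
    ParityPlanar G S := by
  obtain ⟨f, arc, hf, hcont, -, hends, -, hvert, hcross⟩ := h
  let z : ℝ × ℝ → ℂ := equivRealProdCLM.symm
  have hz : Continuous z := equivRealProdCLM.symm.continuous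
  have hzinj : Function.Injective z := equivRealProdCLM.symm.injective
  let l : V → V → ℂ := fun u w => log (z (f u) - z (f w))
  have hl : ∀ u w, u ≠ w → exp (l u w) = z (f u) - z (f w) := fun u w huw =>
    exp_log (sub_ne_zero.2 fun e => huw (hf (hzinj e)))
  have hpi : (2 * Real.pi * Complex.I : ℂ) ≠ 0 := two_pi_I_ne_zero
  have hO : ∀ u w, ∃ O : ℤ, u ≠ w →
      l w u - l u w = Real.pi * Complex.I * (2 * O + 1) := by
    intro u w
    by_cases huw : u = w
    · exact ⟨0, fun h => absurd huw h⟩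
    have : exp (l w u) = exp (l u w + Real.pi * Complex.I) := by
      rw [exp_add, exp_pi_mul_I, hl _ _ huw, hl _ _ (Ne.symm huw)]; ring
    obtain ⟨m, hm⟩ := exp_eq_exp_iff_exists_int.1 this
    exact ⟨m, fun _ => by rw [hm]; ring⟩
  choose O hO using hO
  have hN : ∀ a b w, ∃ N : ℤ, ∀ h : G.Adj a b, a ≠ w → b ≠ w → ∀ θ : I → ℂ, Continuous θ →
      (∀ t, exp (θ t) = z (arc a b h t) - z (f w)) →
      θ 1 - θ 0 = l b w - l a w + N * (2 * Real.pi * Complex.I) := by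
    intro a b w
    by_cases hex : ∃ h : G.Adj a b, a ≠ w ∧ b ≠ w ∧ ∃ θ : I → ℂ, Continuous θ ∧
      (∀ t, exp (θ t) = z (arc a b h t) - z (f w))
    · obtain ⟨h, ha, hb, θ, hθ, hexp⟩ := hex
      have h0 : exp (θ 0) = exp (l a w) := by rw [hexp, hl _ _ ha, (hends a b h).1]
      have h1 : exp (θ 1) = exp (l b w) := by rw [hexp, hl _ _ hb, (hends a b h).2]
      obtain ⟨m0, hm0⟩ := exp_eq_exp_iff_exists_int.1 h0
      obtain ⟨m1, hm1⟩ := exp_eq_exp_iff_exists_int.1 h1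
      refine ⟨m1 - m0, fun _ _ _ θ' hθ' hexp' => ?_⟩
      rw [log_increment_unique hθ' hθ fun t => by rw [hexp, hexp'], hm0, hm1]
      push_cast; ring
    · push Not at hex
      refine ⟨0, fun h ha hb θ hθ hexp => ?_⟩
      obtain ⟨t, ht⟩ := hex h ha hb θ hθ
      exact absurd (hexp t) ht
  choose N hN using hN
  refine ⟨fun u w => O u w, fun a b w => N a b w, fun u w huw => ?_, ?_⟩
  · have h1 := hO u w huw
    have h2 := hO w u huw.symm
    have h3 : (2 * Real.pi * Complex.I : ℂ) * ((O u w + O w u + 1 : ℤ) : ℂ) = 0 := by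
      push_cast; linear_combination -h1 - h2
    have h4 : O u w + O w u + 1 = 0 := by
      rcases mul_eq_zero.1 h3 with h | h
      · exact absurd h hpi
      · exact_mod_cast h
    have h5 : ((O u w + O w u + 1 : ℤ) : ZMod 2) = 0 := by rw [h4]; rfl
    push_cast at h5
    have h6 : (2 : ZMod 2) = 0 := rfl
    linear_combination h5 - h6
  · intro a _ b _ c _ d _ hab hcd hac had hbc hbd
    have hne : ∀ p : I × I, z (arc a b hab p.1) - z (arc c d hcd p.2) ≠ 0 := by
      rintro ⟨s, t⟩ hst
      have hst : arc a b hab s = arc c d hcd t := hzinj (sub_eq_zero.1 hst)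
      have hsym : s(a, b) ≠ s(c, d) := by
        simp [hac, had]
      by_cases hs0 : s = 0
      · subst hs0
        rw [(hends a b hab).1] at hst
        by_cases ht0 : t = 0
        · subst ht0; rw [(hends c d hcd).1] at hst; exact hac (hf hst)
        by_cases ht1 : t = 1
        · subst ht1; rw [(hends c d hcd).2] at hst; exact had (hf hst)
        exact hvert c d hcd t ht0 ht1 a hst.symm
      by_cases hs1 : s = 1
      · subst hs1
        rw [(hends a b hab).2] at hst
        by_cases ht0 : t = 0
        · subst ht0; rw [(hends c d hcd).1] at hst; exact hbc (hf hst)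
        by_cases ht1 : t = 1
        · subst ht1; rw [(hends c d hcd).2] at hst; exact hbd (hf hst)
        exact hvert c d hcd t ht0 ht1 b hst.symm
      exact hcross a b hab c d hcd hsym s t hs0 hs1 hst
    have hcab := hcont a b hab
    have hccd := hcont c d hcd
    obtain ⟨Θ, hΘ, hΘe⟩ := exists_continuous_log
      (g := fun p : I × I => z (arc a b hab p.1) - z (arc c d hcd p.2))
      (by fun_prop) hne
    have e1 := hN a b c hab hac hbc (fun s => Θ (s, 0)) (by fun_prop)
      (fun t => by rw [hΘe]; simp [(hends c d hcd).1])
    have e2 := hN a b d hab had hbd (fun s => Θ (s, 1)) (by fun_prop)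
      (fun t => by rw [hΘe]; simp [(hends c d hcd).2])
    have e3 := hN c d a hcd hac.symm had.symm (fun t => Θ (0, t) + Real.pi * Complex.I)
      (by fun_prop)
      (fun t => by rw [exp_add, hΘe, exp_pi_mul_I]; simp [(hends a b hab).1])
    have e4 := hN c d b hcd hbc.symm hbd.symm (fun t => Θ (1, t) + Real.pi * Complex.I)
      (by fun_prop)
      (fun t => by rw [exp_add, hΘe, exp_pi_mul_I]; simp [(hends a b hab).2])
    have h3 : (2 * Real.pi * Complex.I : ℂ) *
        ((N a b c - N a b d - N c d a + N c d b
          - O b c + O a c + O b d - O a d : ℤ) : ℂ) = 0 * 0 := by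
      push_cast
      linear_combination -e1 + e2 + e3 - e4 + hO b c hbc - hO a c hac - hO b d hbd
        + hO a d had
    have h4 : N a b c - N a b d - N c d a + N c d b
          - O b c + O a c + O b d - O a d = 0 := by
      rcases mul_eq_zero.1 (h3.trans (mul_zero 0)) with h | h
      · exact absurd h hpi
      · exact_mod_cast h
    have h5 : ((N a b c - N a b d - N c d a + N c d b
          - O b c + O a c + O b d - O a d : ℤ) : ZMod 2) = 0 := by rw [h4]; rfl
    push_cast at h5
    have h6 : (2 : ZMod 2) = 0 := rfl
    linear_combination h5 + (N a b d + N c d a - O a c - O b d : ZMod 2) * h6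

end Topology

section Packing

open scoped Classical

variable {V : Type*} {G : SimpleGraph V} {A B S : Finset V} {u v w : V}

/-- The number of neighbours of `v` in `A`. -/
noncomputable def degIn (G : SimpleGraph V) (A : Finset V) (v : V) : ℕ := #{w ∈ A | G.Adj v w}

/-- The number of common neighbours of `u` and `v` in `A`. -/
noncomputable def codegIn (G : SimpleGraph V) (A : Finset V) (u v : V) : ℕ :=
  #{w ∈ A | G.Adj w u ∧ G.Adj w v}

lemma degIn_eq_sum : degIn G A v = ∑ w ∈ A, if G.Adj v w then 1 else 0 := by
  rw [degIn, card_filter]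

lemma degIn_mono (h : A ⊆ B) : degIn G A v ≤ degIn G B v :=
  card_le_card (filter_subset_filter _ h)

lemma degIn_le_card : degIn G A v ≤ #A := card_filter_le _ _

lemma degIn_insert (h : v ∉ A) :
    degIn G (insert v A) w = degIn G A w + if G.Adj w v then 1 else 0 := by
  rw [degIn_eq_sum, degIn_eq_sum, sum_insert h, add_comm]

lemma degIn_erase (h : v ∈ A) :
    degIn G A w = degIn G (A.erase v) w + if G.Adj w v then 1 else 0 := by
  conv_lhs => rw [← insert_erase h]
  exact degIn_insert (notMem_erase _ _)

lemma degIn_sdiff (h : B ⊆ A) : degIn G A w = degIn G (A \ B) w + degIn G B w := by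
  simp only [degIn_eq_sum]
  exact (sum_sdiff h).symm

lemma degIn_erase_self : degIn G (A.erase v) v = degIn G A v := by
  rw [degIn, degIn, filter_erase, erase_eq_of_notMem (by simp)]

lemma sum_degIn_comm : ∑ v ∈ A, degIn G B v = ∑ w ∈ B, degIn G A w := by
  simp only [degIn_eq_sum]
  rw [sum_comm]
  simp only [G.adj_comm]

lemma sum_degIn_insert (h : v ∉ A) :
    ∑ w ∈ insert v A, degIn G (insert v A) w = ∑ w ∈ A, degIn G A w + 2 * degIn G A v := by
  rw [sum_insert h, degIn_insert h]
  simp only [degIn_insert h, sum_add_distrib]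
  have : degIn G A v = ∑ w ∈ A, if G.Adj w v then 1 else 0 := by
    rw [degIn_eq_sum]; simp only [G.adj_comm]
  simp only [G.irrefl, if_false]
  omega

lemma exists_adj_of_degIn_pos (h : 0 < degIn G A v) : ∃ w ∈ A, G.Adj v w := by
  obtain ⟨w, hw⟩ := card_pos.1 h
  exact ⟨w, (mem_filter.1 hw).1, (mem_filter.1 hw).2⟩

lemma degIn_pos (hw : w ∈ A) (h : G.Adj v w) : 0 < degIn G A v :=
  card_pos.2 ⟨w, mem_filter.2 ⟨hw, h⟩⟩

lemma two_le_degIn {x y : V} (hx : x ∈ A) (hy : y ∈ A) (hxy : x ≠ y) (h1 : G.Adj v x)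
    (h2 : G.Adj v y) : 2 ≤ degIn G A v :=
  one_lt_card.2 ⟨x, mem_filter.2 ⟨hx, h1⟩, y, mem_filter.2 ⟨hy, h2⟩, hxy⟩

lemma degIn_triple {x y z : V} (hxy : x ≠ y) (hxz : x ≠ z) (hyz : y ≠ z) :
    degIn G {x, y, z} w = (if G.Adj w x then 1 else 0) + (if G.Adj w y then 1 else 0)
      + if G.Adj w z then 1 else 0 := by
  rw [degIn_eq_sum, sum_insert (by simp [hxy, hxz]), sum_insert (by simp [hyz]), sum_singleton,
    add_assoc]

/-- `A` spans a subgraph containing a cycle, witnessed by a nonempty set in which every vertex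
has two neighbours. -/
def HasCore (G : SimpleGraph V) (A : Finset V) : Prop :=
  ∃ B ⊆ A, B.Nonempty ∧ ∀ v ∈ B, 2 ≤ degIn G B v

lemma HasCore.mono (h : HasCore G A) (hAB : A ⊆ B) : HasCore G B := by
  obtain ⟨C, hC, h⟩ := h
  exact ⟨C, hC.trans hAB, h⟩

lemma hasCore_triangle {x y z : V} (hxy : G.Adj x y) (hxz : G.Adj x z) (hyz : G.Adj y z) :
    HasCore G {x, y, z} := by
  refine ⟨_, Subset.rfl, ⟨x, by simp⟩, fun v hv => ?_⟩
  simp only [degIn_triple hxy.ne hxz.ne hyz.ne]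
  simp only [mem_insert, mem_singleton] at hv
  rcases hv with rfl | rfl | rfl <;> simp [*, hxy.symm, hxz.symm, hyz.symm]

lemma exists_degIn_le_one (h : ¬ HasCore G A) (hB : B ⊆ A) (hne : B.Nonempty) :
    ∃ v ∈ B, degIn G B v ≤ 1 := by
  by_contra! hc
  exact h ⟨B, hB, hne, fun v hv => hc v hv⟩

lemma sum_degIn_of_not_hasCore (h : ¬ HasCore G A) (hne : A.Nonempty) :
    ∑ v ∈ A, degIn G A v + 2 ≤ 2 * #A := by
  induction A using Finset.strongInduction with
  | H A ih =>
    obtain ⟨v, hv, hd⟩ := exists_degIn_le_one h Subset.rfl hne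
    have hins := insert_erase hv
    have hsum := sum_degIn_insert (G := G) (notMem_erase v A)
    rw [hins, degIn_erase_self] at hsum
    have hc := card_erase_add_one hv
    by_cases hne' : (A.erase v).Nonempty
    · have := ih _ (erase_ssubset hv) (fun hc => h (hc.mono (erase_subset _ _))) hne'
      omega
    · rw [not_nonempty_iff_eq_empty] at hne'
      have h0 : degIn G A v = 0 := by
        rw [← degIn_erase_self, hne']; simp [degIn]
      rw [hne'] at hsum hc
      simp at hsum hc
      simp only [hsum, h0]; omega

/-- The graph in which `u` has absorbed the neighbours of `v`; on vertex sets without `v` this is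
the contraction of the edge `uv` into `u`. -/
def absorb (G : SimpleGraph V) (u v : V) : SimpleGraph V where
  Adj x y := x ≠ y ∧ (G.Adj x y ∨ x = u ∧ G.Adj v y ∨ y = u ∧ G.Adj v x)
  symm := ⟨fun x y h => ⟨h.1.symm, by have := G.adj_comm x y; tauto⟩⟩
  loopless := ⟨fun x h => h.1 rfl⟩

lemma le_absorb : G ≤ absorb G u v := fun _ _ h => ⟨h.ne, Or.inl h⟩

lemma absorb_adj_of_ne {x y : V} (hx : x ≠ u) (hy : y ≠ u) :
    (absorb G u v).Adj x y ↔ G.Adj x y :=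
  ⟨fun h => by simpa [hx, hy] using h.2, fun h => le_absorb h⟩

lemma degIn_absorb_of_notMem (hu : u ∉ A) (hw : w ≠ u) :
    degIn (absorb G u v) A w = degIn G A w := by
  unfold degIn
  congr 1
  refine filter_congr fun x hx => absorb_adj_of_ne hw ?_
  rintro rfl; exact hu hx

lemma degIn_absorb (hu : u ∈ A) (hv : v ∈ A) (huv : G.Adj u v) (hwu : w ≠ u) :
    degIn (absorb G u v) (A.erase v) w + (if G.Adj w u ∧ G.Adj w v then 1 else 0)
      = degIn G A w := by
  have hu' : u ∈ A.erase v := mem_erase.2 ⟨huv.ne, hu⟩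
  rw [degIn_erase (G := G) hv, degIn_erase (G := G) hu', degIn_erase (G := absorb G u v) hu',
    degIn_absorb_of_notMem (notMem_erase _ _) hwu]
  have : (absorb G u v).Adj w u ↔ G.Adj w u ∨ G.Adj w v := by
    simp [absorb, hwu, G.adj_comm v w]
  rw [if_congr this rfl rfl]
  by_cases h1 : G.Adj w u <;> by_cases h2 : G.Adj w v <;> simp [h1, h2]

lemma degIn_absorb_self (hu : u ∈ A) (hv : v ∈ A) (huv : G.Adj u v) :
    degIn (absorb G u v) (A.erase v) u + 2 + codegIn G A u v = degIn G A u + degIn G A v := by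
  have h1 : ({w ∈ A.erase v | (absorb G u v).Adj u w} : Finset V) =
      ((({w ∈ A | G.Adj u w} : Finset V) ∪ ({w ∈ A | G.Adj v w} : Finset V)).erase u).erase v := by
    ext x
    simp only [mem_filter, mem_erase, mem_union, absorb]
    have := huv.ne
    by_cases hx : x = u
    · subst hx; simp
    · simp [hx, Ne.symm hx]; tauto
  have h2 : codegIn G A u v =
      #(({w ∈ A | G.Adj u w} : Finset V) ∩ ({w ∈ A | G.Adj v w} : Finset V)) := by
    unfold codegIn
    congr 1; ext x; simp [G.adj_comm x]; tauto
  have h3 := card_union_add_card_inter ({w ∈ A | G.Adj u w} : Finset V)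
    ({w ∈ A | G.Adj v w} : Finset V)
  have h4 : u ∈ ({w ∈ A | G.Adj u w} : Finset V) ∪ ({w ∈ A | G.Adj v w} : Finset V) := by
    simp [hu, huv.symm]
  have h5 : v ∈ (({w ∈ A | G.Adj u w} : Finset V) ∪
      ({w ∈ A | G.Adj v w} : Finset V)).erase u := by
    simp [hv, huv, huv.ne']
  have h6 := card_erase_add_one h4
  have h7 := card_erase_add_one h5
  unfold degIn at *
  rw [h1, h2]
  omega

lemma codegIn_eq_sum (huv : G.Adj u v) :
    codegIn G A u v =
      ∑ w ∈ (A.erase v).erase u, if G.Adj w u ∧ G.Adj w v then 1 else 0 := by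
  rw [codegIn, card_filter]
  symm
  refine sum_subset ((erase_subset _ _).trans (erase_subset _ _)) fun x hx hx' => ?_
  have : x = u ∨ x = v := by
    simp only [mem_erase, hx] at hx'; tauto
  rcases this with rfl | rfl <;> simp

lemma sum_degIn_absorb (hu : u ∈ A) (hv : v ∈ A) (huv : G.Adj u v) :
    ∑ w ∈ A.erase v, degIn (absorb G u v) (A.erase v) w + 2 + 2 * codegIn G A u v
      = ∑ w ∈ A, degIn G A w := by
  have hu' : u ∈ A.erase v := mem_erase.2 ⟨huv.ne, hu⟩
  rw [← add_sum_erase _ _ hv, ← add_sum_erase _ _ hu', ← add_sum_erase _ _ hu']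
  have h1 : ∑ w ∈ (A.erase v).erase u, degIn (absorb G u v) (A.erase v) w + codegIn G A u v
      = ∑ w ∈ (A.erase v).erase u, degIn G A w := by
    rw [codegIn_eq_sum huv, ← sum_add_distrib]
    refine sum_congr rfl fun w hw => ?_
    simp only [mem_erase] at hw
    exact degIn_absorb hu hv huv hw.1
  have := degIn_absorb_self hu hv huv
  omega

lemma HasCore.of_absorb (huv : G.Adj u v) (hvA : v ∉ A) (h : HasCore (absorb G u v) A) :
    HasCore G (if u ∈ A then insert v A else A) := by
  obtain ⟨B, hBA, hne, hB⟩ := h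
  by_cases hu : u ∈ B
  · rw [if_pos (hBA hu)]
    by_contra hc
    have hvB : v ∉ B := fun h => hvA (hBA h)
    have h1 : ¬ HasCore G (insert v B) := fun h => hc (h.mono (insert_subset_insert _ hBA))
    have h2 := sum_degIn_of_not_hasCore h1 (insert_nonempty _ _)
    have h3 := sum_degIn_absorb (mem_insert_of_mem hu) (mem_insert_self v B) huv
    rw [erase_insert hvB] at h3
    have h4 : #B • 2 ≤ ∑ w ∈ B, degIn (absorb G u v) B w := card_nsmul_le_sum B _ 2 hB
    rw [card_insert_of_notMem hvB] at h2
    simp only [smul_eq_mul] at h4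
    omega
  · have : HasCore G A := ⟨B, hBA, hne, fun w hw => by
      rw [← degIn_absorb_of_notMem (v := v) hu (by rintro rfl; exact hu hw)]; exact hB w hw⟩
    split_ifs
    · exact this.mono (subset_insert _ _)
    · exact this

/-- `S` contains `k` disjoint sets each spanning a cycle. -/
def Packs (G : SimpleGraph V) (S : Finset V) (k : ℕ) : Prop :=
  ∃ C : Fin k → Finset V, (∀ i, C i ⊆ S ∧ HasCore G (C i)) ∧ ∀ i j, i ≠ j → Disjoint (C i) (C j)

lemma Packs.mono {k : ℕ} (h : Packs G A k) (hAB : A ⊆ B) : Packs G B k := by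
  obtain ⟨C, hC, hd⟩ := h
  exact ⟨C, fun i => ⟨(hC i).1.trans hAB, (hC i).2⟩, hd⟩

lemma Packs.cons {k : ℕ} {T : Finset V} (hT : T ⊆ S) (hc : HasCore G T)
    (h : Packs G (S \ T) k) : Packs G S (k + 1) := by
  obtain ⟨C, hC, hd⟩ := h
  have hCT : ∀ i, Disjoint T (C i) := fun i => disjoint_sdiff.mono_right (hC i).1
  refine ⟨Fin.cons T C, fun i => ?_, fun i j => ?_⟩
  · cases i using Fin.cases with
    | zero => exact ⟨hT, hc⟩
    | succ i => exact ⟨(hC i).1.trans sdiff_subset, (hC i).2⟩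
  · cases i using Fin.cases with
    | zero =>
      cases j using Fin.cases with
      | zero => simp
      | succ j => intro _; simpa using hCT j
    | succ i =>
      cases j using Fin.cases with
      | zero => intro _; simpa using (hCT i).symm
      | succ j => intro h; simpa using hd i j (by rintro rfl; exact h rfl)

lemma packs_one (h : HasCore G A) : Packs G A 1 :=
  Packs.cons Subset.rfl h ⟨fun i => i.elim0, fun i => i.elim0, fun i => i.elim0⟩

lemma packs_two (hA : A ⊆ S) (hB : B ⊆ S) (hAB : Disjoint A B) (h1 : HasCore G A)
    (h2 : HasCore G B) : Packs G S 2 :=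
  Packs.cons hA h1 ((packs_one h2).mono (subset_sdiff.2 ⟨hB, hAB.symm⟩))

lemma Packs.of_absorb {k : ℕ} (huv : G.Adj u v) (hv : v ∈ S)
    (h : Packs (absorb G u v) (S.erase v) k) : Packs G S k := by
  obtain ⟨C, hC, hd⟩ := h
  have hvC : ∀ i, v ∉ C i := fun i hi => notMem_erase v S ((hC i).1 hi)
  refine ⟨fun i => if u ∈ C i then insert v (C i) else C i, fun i => ⟨?_, ?_⟩, fun i j hij => ?_⟩
  · have := (hC i).1.trans (erase_subset _ _)
    dsimp only
    split_ifs
    · exact insert_subset hv this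
    · exact this
  · exact (hC i).2.of_absorb huv (hvC i)
  · have h1 := hd i j hij
    dsimp only
    split_ifs with hi hj hj
    · exact absurd hj (disjoint_left.1 h1 hi)
    · simp [h1, hvC]
    · simp [h1, hvC]
    · exact h1

lemma exists_cycle_of_hasCore (h : HasCore G A) :
    ∃ (v : V) (c : G.Walk v v), c.IsCycle ∧ ∀ x ∈ c.support, x ∈ A := by
  obtain ⟨B, hBA, ⟨b, hb⟩, hB⟩ := h
  have hac : ¬ (G.induce (B : Set V)).IsAcyclic := by
    intro hac
    have : Nonempty (B : Set V) := ⟨⟨b, hb⟩⟩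
    obtain ⟨u, v, p, hp, hmax⟩ :=
      SimpleGraph.Walk.exists_isPath_forall_isPath_length_le_length (G.induce (B : Set V))
    obtain ⟨x, hx, y, hy, hxy⟩ := one_lt_card.1 (hB u u.2)
    rw [mem_filter] at hx hy
    have key : ∀ z : V, ∀ hz : z ∈ B, G.Adj u z → (⟨z, hz⟩ : (B : Set V)) = p.snd := by
      intro z hz hadj
      have hadj' : (G.induce (B : Set V)).Adj u ⟨z, hz⟩ := hadj
      refine hac.eq_snd_of_adj_start hp hadj' ?_
      by_contra hns
      have := hmax _ _ (SimpleGraph.Walk.cons hadj'.symm p) (hp.cons hns)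
      simp at this
    have := (key x hx.1 hx.2).trans (key y hy.1 hy.2).symm
    exact hxy (congrArg Subtype.val this)
  unfold SimpleGraph.IsAcyclic at hac
  push Not at hac
  obtain ⟨v, c, hc⟩ := hac
  refine ⟨v, c.map (SimpleGraph.Embedding.induce (B : Set V)).toHom,
    hc.map Subtype.val_injective, fun x hx => ?_⟩
  obtain ⟨y, -, rfl⟩ := List.mem_map.1 ((SimpleGraph.Walk.support_map _ c) ▸ hx)
  exact hBA y.2

lemma Packs.hasDisjointCycles {k : ℕ} (h : Packs G S k) : HasDisjointCycles G k := by
  obtain ⟨C, hC, hd⟩ := h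
  choose v c hc hs using fun i => exists_cycle_of_hasCore (hC i).2
  exact ⟨v, c, hc, fun i j hij x hi hj =>
    disjoint_left.1 (hd i j hij) (hs i x hi) (hs j x hj)⟩

end Packing

section Planarity

open scoped Classical

variable {V : Type*} {G : SimpleGraph V} {A S : Finset V} {u v : V}

lemma ParityPlanar.mono {G' : SimpleGraph V} (h : ParityPlanar G S) (hG : G' ≤ G) (hA : A ⊆ S) :
    ParityPlanar G' A := by
  obtain ⟨o, n, ho, hn⟩ := h
  exact ⟨o, n, ho, fun a ha b hb c hc d hd hab hcd =>
    hn a (hA ha) b (hA hb) c (hA hc) d (hA hd) (hG hab) (hG hcd)⟩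

lemma ParityPlanar.absorb (h : ParityPlanar G S) (huv : G.Adj u v) (hv : v ∈ S) :
    ParityPlanar (absorb G u v) (S.erase v) := by
  obtain ⟨o, n, ho, hn⟩ := h
  have key : ∀ a ∈ S.erase v, ∀ b ∈ S.erase v, ∀ c ∈ S.erase v, ∀ d ∈ S.erase v,
      (_root_.absorb G u v).Adj a b → G.Adj c d → a ≠ c → a ≠ d → b ≠ c → b ≠ d →
      (if G.Adj a b then n a b c else if a = u then n u v c + n v b c else n a v c + n v u c) +
      (if G.Adj a b then n a b d else if a = u then n u v d + n v b d else n a v d + n v u d) +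
      n c d a + n c d b = o a c + o a d + o b c + o b d := by
    intro a ha b hb c hc d hd hab hcd hac had hbc hbd
    rw [mem_erase] at ha hb hc hd
    have h2 : ∀ x : ZMod 2, x + x = 0 := CharTwo.add_self_eq_zero
    split_ifs with h1 hau
    · exact hn a ha.2 b hb.2 c hc.2 d hd.2 h1 hcd hac had hbc hbd
    · subst hau
      have hvb : G.Adj v b := by
        have := hab.2
        have := hab.1
        tauto
      linear_combination hn a ha.2 v hv c hc.2 d hd.2 huv hcd hac had hc.1.symm hd.1.symm +
        hn v hv b hb.2 c hc.2 d hd.2 hvb hcd hc.1.symm hd.1.symm hbc hbd -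
        h2 (n c d v) + h2 (o v c) + h2 (o v d)
    · obtain ⟨rfl, hva⟩ : b = u ∧ G.Adj v a := by
        have := hab.2
        tauto
      linear_combination hn a ha.2 v hv c hc.2 d hd.2 hva.symm hcd hac had hc.1.symm hd.1.symm +
        hn v hv b hb.2 c hc.2 d hd.2 huv.symm hcd hc.1.symm hd.1.symm hbc hbd -
        h2 (n c d v) + h2 (o v c) + h2 (o v d)
  refine ⟨o, fun x y w => if G.Adj x y then n x y w else
    if x = u then n u v w + n v y w else n x v w + n v u w, ho, ?_⟩
  intro a ha b hb c hc d hd hab hcd hac had hbc hbd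
  by_cases h1 : G.Adj c d
  · simpa only [if_pos h1] using key a ha b hb c hc d hd hab h1 hac had hbc hbd
  · have h2 : G.Adj a b := by
      have := hab.2
      have := hcd.2
      by_contra hc
      obtain h3 | h3 : a = u ∨ b = u := by tauto
      all_goals obtain h4 | h4 : c = u ∨ d = u := by tauto
      all_goals subst h3; subst h4; simp at hac had hbc hbd
    have := key c hc d hd a ha b hb hcd h2 hac.symm hbc.symm had.symm hbd.symm
    simp only [if_pos h2]
    linear_combination (norm := (ring_nf; reduce_mod_char)) this + ho a c hac + ho a d had +
      ho b c hbc + ho b d hbd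

lemma ParityPlanar.not_clique_five (h : ParityPlanar G S) {a b c d e : V} (ha : a ∈ S)
    (hb : b ∈ S) (hc : c ∈ S) (hd : d ∈ S) (he : e ∈ S) (hab : G.Adj a b) (hac : G.Adj a c)
    (had : G.Adj a d) (hae : G.Adj a e) (hbc : G.Adj b c) (hbd : G.Adj b d) (hbe : G.Adj b e)
    (hcd : G.Adj c d) (hce : G.Adj c e) (hde : G.Adj d e) : False := by
  obtain ⟨o, n, ho, hn⟩ := h
  have key : ∀ x ∈ S, ∀ y ∈ S, ∀ z ∈ S, ∀ w ∈ S, G.Adj x y → G.Adj x z → G.Adj x w →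
      G.Adj y z → G.Adj y w → G.Adj z w →
      n x y z + n x y w + n x z y + n x z w + n x w y + n x w z +
      n y z x + n y z w + n y w x + n y w z + n z w x + n z w y = 1 := by
    intro x hx y hy z hz w hw h1 h2 h3 h4 h5 h6
    linear_combination (norm := (ring_nf; reduce_mod_char))
      hn x hx y hy z hz w hw h1 h6 h2.ne h3.ne h4.ne h5.ne +
      hn x hx z hz y hy w hw h2 h5 h1.ne h3.ne h4.ne.symm h6.ne +
      hn x hx w hw y hy z hz h3 h4 h1.ne h2.ne h5.ne.symm h6.ne.symm +
      ho y z h4.ne + ho y w h5.ne + ho z w h6.ne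
  have h1 := key a ha b hb c hc d hd hab hac had hbc hbd hcd
  have h2 := key a ha b hb c hc e he hab hac hae hbc hbe hce
  have h3 := key a ha b hb d hd e he hab had hae hbd hbe hde
  have h4 := key a ha c hc d hd e he hac had hae hcd hce hde
  have h5 := key b hb c hc d hd e he hbc hbd hbe hcd hce hde
  have h6 : (1 : ZMod 2) = 0 := by
    linear_combination (norm := (ring_nf; reduce_mod_char)) h1 + h2 + h3 + h4 + h5
  exact absurd h6 (by decide)

end Planarity

section EdgeBounds

open scoped Classical

variable {V : Type*} {G : SimpleGraph V} {A S : Finset V} {u v : V}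

lemma codegIn_eq_degIn_filter :
    codegIn G A u v = degIn G ({w ∈ A | G.Adj u w} : Finset V) v := by
  rw [codegIn, degIn, filter_filter]
  simp only [G.adj_comm u, G.adj_comm v]

lemma sum_degIn_le_mul_pred : ∑ v ∈ A, degIn G A v ≤ #A * (#A - 1) := by
  refine sum_le_card_nsmul _ _ _ fun v hv => ?_
  rw [← degIn_erase_self, ← card_erase_of_mem hv]
  exact degIn_le_card

lemma sum_degIn_erase (hv : v ∈ A) :
    ∑ w ∈ A, degIn G A w = ∑ w ∈ A.erase v, degIn G (A.erase v) w + 2 * degIn G A v := by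
  have := sum_degIn_insert (G := G) (notMem_erase v A)
  rwa [insert_erase hv, degIn_erase_self] at this

/-- The common neighbours of two adjacent vertices span a forest. -/
lemma ParityPlanar.sum_degIn_common_nbrs (h : ParityPlanar G S) {x y : V} (hx : x ∈ S)
    (hy : y ∈ S) (hxy : G.Adj x y) (hAS : A ⊆ S) (hA : ∀ a ∈ A, G.Adj x a ∧ G.Adj y a)
    (hne : A.Nonempty) : ∑ v ∈ A, degIn G A v + 2 ≤ 2 * #A := by
  induction hm : #A using Nat.strong_induction_on generalizing G S A with
  | _ m ih =>
  subst hm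
  by_cases hE : ∃ u ∈ A, ∃ v ∈ A, G.Adj u v
  · obtain ⟨u, hu, v, hv, huv⟩ := hE
    have hco : codegIn G A u v = 0 := by
      rw [codegIn, card_eq_zero, filter_eq_empty_iff]
      rintro w hw ⟨h1, h2⟩
      exact h.not_clique_five hx hy (hAS hu) (hAS hv) (hAS hw) hxy (hA u hu).1 (hA v hv).1
        (hA w hw).1 (hA u hu).2 (hA v hv).2 (hA w hw).2 huv h1.symm h2.symm
    have hcard := card_erase_add_one hv
    have := ih _ (by omega) (h.absorb huv (hAS hv)) (mem_erase.2 ⟨(hA v hv).1.ne, hx⟩)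
      (mem_erase.2 ⟨(hA v hv).2.ne, hy⟩) (le_absorb hxy) (erase_subset_erase v hAS)
      (fun a ha => ⟨le_absorb (hA a (mem_of_mem_erase ha)).1,
        le_absorb (hA a (mem_of_mem_erase ha)).2⟩) ⟨u, mem_erase.2 ⟨huv.ne, hu⟩⟩ rfl
    have := sum_degIn_absorb hu hv huv
    omega
  · have : ∑ v ∈ A, degIn G A v = 0 := by
      refine sum_eq_zero fun v hv => ?_
      by_contra hc
      obtain ⟨w, hw, hvw⟩ := exists_adj_of_degIn_pos (Nat.pos_of_ne_zero hc)
      exact hE ⟨v, hv, w, hw, hvw⟩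
    have := hne.card_pos
    omega

/-- In a neighbourhood, no vertex can form at least two triangles with each of its neighbours. -/
lemma ParityPlanar.exists_codegIn_le_one (h : ParityPlanar G S) {x : V} (hx : x ∈ S)
    (hAS : A ⊆ S) (hA : ∀ a ∈ A, G.Adj x a) (hu : u ∈ A) (hd : 0 < degIn G A u) :
    ∃ v ∈ A, G.Adj u v ∧ codegIn G A u v ≤ 1 := by
  by_contra! hc
  obtain ⟨w, hw, huw⟩ := exists_adj_of_degIn_pos hd
  have h1 := h.sum_degIn_common_nbrs (A := {w ∈ A | G.Adj u w}) hx (hAS hu) (hA u hu)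
    ((filter_subset _ _).trans hAS) (fun a ha => ⟨hA a (mem_filter.1 ha).1, (mem_filter.1 ha).2⟩)
    ⟨w, mem_filter.2 ⟨hw, huw⟩⟩
  have h2 : #{w ∈ A | G.Adj u w} • 2 ≤ ∑ v ∈ A with G.Adj u v, degIn G {w ∈ A | G.Adj u w} v :=
    card_nsmul_le_sum _ _ _ fun v hv => by
      rw [← codegIn_eq_degIn_filter]
      exact hc v (mem_filter.1 hv).1 (mem_filter.1 hv).2
  simp only [smul_eq_mul] at h2
  omega

/-- Neighbourhoods in planar graphs are outerplanar, hence span few edges. -/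
lemma ParityPlanar.sum_degIn_nbrs (h : ParityPlanar G S) {x : V} (hx : x ∈ S)
    (hAS : A ⊆ S) (hA : ∀ a ∈ A, G.Adj x a) (hcard : 2 ≤ #A) :
    ∑ v ∈ A, degIn G A v + 6 ≤ 4 * #A := by
  induction hm : #A using Nat.strong_induction_on generalizing G S A with
  | _ m ih =>
  subst hm
  rcases hcard.eq_or_lt with h2 | h3
  · have := sum_degIn_le_mul_pred (G := G) (A := A)
    rw [← h2] at this ⊢
    omega
  by_cases hE : ∃ u ∈ A, 0 < degIn G A u
  · obtain ⟨u, hu, hd⟩ := hE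
    obtain ⟨v, hv, huv, hco⟩ := h.exists_codegIn_le_one hx hAS hA hu hd
    have hcard := card_erase_add_one hv
    have := ih _ (by omega) (h.absorb huv (hAS hv)) (mem_erase.2 ⟨(hA v hv).ne, hx⟩)
      (erase_subset_erase v hAS) (fun a ha => le_absorb (hA a (mem_of_mem_erase ha)))
      (by omega) rfl
    have := sum_degIn_absorb hu hv huv
    omega
  · have : ∑ v ∈ A, degIn G A v = 0 := sum_eq_zero fun v hv => by
      by_contra hc
      exact hE ⟨v, hv, Nat.pos_of_ne_zero hc⟩
    omega

lemma degIn_le_of_adj_or {G' : SimpleGraph V} {w : V}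
    (hG : ∀ x y, G.Adj x y → G'.Adj x y ∨ x = u ∧ y = v ∨ x = v ∧ y = u) :
    degIn G A w ≤ degIn G' A w + (if w = u then 1 else 0) + if w = v then 1 else 0 := by
  have h : ({x ∈ A | G.Adj w x} : Finset V) ⊆
      {x ∈ A | G'.Adj w x} ∪ (if w = u then {v} else ∅) ∪ if w = v then {u} else ∅ := by
    intro x hx
    rw [mem_filter] at hx
    have := hG w x hx.2
    simp only [mem_union, mem_filter, hx, true_and]
    split_ifs <;> simp <;> tauto
  refine (card_le_card h).trans ((card_union_le _ _).trans (Nat.add_le_add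
    ((card_union_le _ _).trans (Nat.add_le_add le_rfl ?_)) ?_))
  · split_ifs <;> simp
  · split_ifs <;> simp

/-- Euler's bound on the number of edges of a planar graph. -/
lemma ParityPlanar.sum_degIn_le (h : ParityPlanar G S) (hcard : 3 ≤ #S) :
    ∑ v ∈ S, degIn G S v + 12 ≤ 6 * #S := by
  induction hm : #S + ∑ v ∈ S, degIn G S v using Nat.strong_induction_on generalizing G S with
  | _ m ih =>
  subst hm
  rcases hcard.eq_or_lt with h3 | h4
  · have := sum_degIn_le_mul_pred (G := G) (A := S)
    rw [← h3] at this ⊢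
    omega
  by_cases hlow : ∃ v ∈ S, degIn G S v ≤ 3
  · obtain ⟨v, hv, hd⟩ := hlow
    have hcard := card_erase_add_one hv
    have hsum := sum_degIn_erase (G := G) hv
    have := ih _ (by omega) (h.mono le_rfl (erase_subset v S)) (by omega) rfl
    omega
  by_cases hE : ∃ u ∈ S, ∃ v ∈ S, G.Adj u v ∧ codegIn G S u v ≤ 2
  · obtain ⟨u, hu, v, hv, huv, hco⟩ := hE
    have hcard := card_erase_add_one hv
    have := sum_degIn_absorb hu hv huv
    have := ih _ (by omega) (h.absorb huv hv) (by omega) rfl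
    omega
  push Not at hlow hE
  by_cases hlow5 : ∃ v ∈ S, degIn G S v ≤ 5
  · obtain ⟨v, hv, hd⟩ := hlow5
    have h1 := h.sum_degIn_nbrs (A := {w ∈ S | G.Adj v w}) hv (filter_subset _ _)
      (fun a ha => (mem_filter.1 ha).2) (Nat.lt_of_lt_of_le (by simp) (hlow v hv))
    have h2 : #{w ∈ S | G.Adj v w} • 3 ≤
        ∑ w ∈ S with G.Adj v w, degIn G {w ∈ S | G.Adj v w} w :=
      card_nsmul_le_sum _ _ _ fun w hw => by
        rw [← codegIn_eq_degIn_filter]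
        exact hE v hv w (mem_filter.1 hw).1 (mem_filter.1 hw).2
    simp only [smul_eq_mul] at h2
    unfold degIn at hd
    omega
  · push Not at hlow5
    obtain ⟨u, hu⟩ : S.Nonempty := card_pos.1 (by omega)
    obtain ⟨v, hv, huv⟩ := exists_adj_of_degIn_pos ((Nat.zero_lt_succ _).trans (hlow5 u hu))
    have h1 : ∑ w ∈ S, degIn G S w ≤ ∑ w ∈ S, degIn (G.deleteEdges {s(u, v)}) S w + 2 := by
      refine (sum_le_sum fun w _ => degIn_le_of_adj_or (G' := G.deleteEdges {s(u, v)})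
        (u := u) (v := v) fun x y hxy => ?_).trans ?_
      · simp only [SimpleGraph.deleteEdges_adj, Set.mem_singleton_iff, Sym2.eq_iff]
        tauto
      simp only [sum_add_distrib, sum_ite_eq', hu, hv, if_true]
      omega
    have h2 : ∑ w ∈ S, degIn (G.deleteEdges {s(u, v)}) S w < ∑ w ∈ S, degIn G S w := by
      refine sum_lt_sum (fun w _ => card_le_card fun x hx => ?_) ⟨u, hu, card_lt_card ?_⟩
      · simp only [mem_filter, SimpleGraph.deleteEdges_adj] at hx ⊢
        exact ⟨hx.1, hx.2.1⟩
      · rw [ssubset_iff_of_subset fun x hx => by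
          simp only [mem_filter, SimpleGraph.deleteEdges_adj] at hx ⊢
          exact ⟨hx.1, hx.2.1⟩]
        exact ⟨v, by simp [hv, huv], by simp⟩
    have h3 : #S • 6 ≤ ∑ w ∈ S, degIn G S w := card_nsmul_le_sum _ _ _ fun w hw => hlow5 w hw
    simp only [smul_eq_mul] at h3
    have := ih _ (by omega) (h.mono (SimpleGraph.deleteEdges_le {s(u, v)}) Subset.rfl) hcard rfl
    omega

end EdgeBounds

section Score

open scoped Classical

variable {V : Type*} {G : SimpleGraph V} {A S : Finset V} {u v : V} {k : ℕ}

/-- `1` if `d` is at least `2 * k`, `-1` if `d` is at most `2 * k - 2`, and `0` otherwise. -/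
def degSign (k d : ℕ) : ℤ := max (-1) (min 1 ((d : ℤ) - (2 * k - 1)))

/-- The number of vertices of high degree minus the number of vertices of low degree in the
subgraph spanned by `S`. -/
noncomputable def score (G : SimpleGraph V) (S : Finset V) (k : ℕ) : ℤ :=
  ∑ v ∈ S, degSign k (degIn G S v)

lemma degSign_le_one {d : ℕ} : degSign k d ≤ 1 := by unfold degSign; omega

lemma degSign_mono {d e : ℕ} (h : d ≤ e) : degSign k d ≤ degSign k e := by
  unfold degSign; omega

lemma degSign_add_le {d e : ℕ} : degSign k (d + e) ≤ degSign k d + e := by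
  unfold degSign; omega

lemma degSign_of_low {d : ℕ} (h : d + 2 ≤ 2 * k) : degSign k d = -1 := by
  unfold degSign; omega

lemma score_erase (hv : v ∈ S) :
    score G S k ≤ score G (S.erase v) k + degSign k (degIn G S v) + degIn G S v := by
  have h1 : ∑ w ∈ S.erase v, degSign k (degIn G S w) ≤
      ∑ w ∈ S.erase v, (degSign k (degIn G (S.erase v) w) + if G.Adj v w then 1 else 0) := by
    refine sum_le_sum fun w _ => ?_
    rw [degIn_erase hv]
    refine degSign_add_le.trans_eq ?_
    simp [G.adj_comm]
  have h2 : (∑ w ∈ S.erase v, if G.Adj v w then 1 else 0 : ℤ) = degIn G S v := by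
    rw [← degIn_erase_self, degIn_eq_sum]; simp
  rw [sum_add_distrib, h2] at h1
  rw [score, score, ← add_sum_erase _ _ hv]
  omega

lemma score_absorb (hu : u ∈ S) (hv : v ∈ S) (huv : G.Adj u v)
    (hd : 2 + codegIn G S u v ≤ degIn G S v) :
    score G S k ≤ score (absorb G u v) (S.erase v) k + degSign k (degIn G S v) +
      #{w ∈ S | (G.Adj w u ∧ G.Adj w v) ∧ degIn G S w ≤ 2 * k} := by
  have hu' : u ∈ S.erase v := mem_erase.2 ⟨huv.ne, hu⟩
  have h1 : ∑ w ∈ (S.erase v).erase u, degSign k (degIn G S w) ≤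
      ∑ w ∈ (S.erase v).erase u, (degSign k (degIn (absorb G u v) (S.erase v) w) +
        if (G.Adj w u ∧ G.Adj w v) ∧ degIn G S w ≤ 2 * k then 1 else 0) := by
    refine sum_le_sum fun w hw => ?_
    have := degIn_absorb hu hv huv (mem_erase.1 hw).1
    unfold degSign
    by_cases h3 : G.Adj w u ∧ G.Adj w v <;> by_cases h4 : degIn G S w ≤ 2 * k <;>
      simp only [h3, h4, if_true, if_false, and_self, and_false, false_and] at this ⊢ <;> omega
  have h2 : (∑ w ∈ (S.erase v).erase u,
      if (G.Adj w u ∧ G.Adj w v) ∧ degIn G S w ≤ 2 * k then 1 else 0 : ℤ) ≤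
      #{w ∈ S | (G.Adj w u ∧ G.Adj w v) ∧ degIn G S w ≤ 2 * k} := by
    rw [← Nat.cast_one, ← Nat.cast_zero, card_filter]
    push_cast
    exact sum_le_sum_of_subset_of_nonneg ((erase_subset _ _).trans (erase_subset _ _))
      fun _ _ _ => by split_ifs <;> simp
  have h3 : degSign k (degIn G S u) ≤ degSign k (degIn (absorb G u v) (S.erase v) u) := by
    have := degIn_absorb_self hu hv huv
    exact degSign_mono (by omega)
  rw [sum_add_distrib] at h1
  rw [score, score, ← add_sum_erase _ _ hv, ← add_sum_erase _ _ hu', ← add_sum_erase _ _ hu']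
  omega

lemma card_filter_low_le_codegIn :
    #{w ∈ S | (G.Adj w u ∧ G.Adj w v) ∧ degIn G S w ≤ 2 * k} ≤ codegIn G S u v :=
  card_le_card fun w hw => by
    rw [mem_filter] at hw ⊢
    exact ⟨hw.1, hw.2.1⟩

/-- Removing a triangle through a vertex of low degree. -/
lemma score_sdiff_triangle {x y z : V} (hx : x ∈ S) (hy : y ∈ S) (hz : z ∈ S) (hxy : G.Adj x y)
    (hxz : G.Adj x z) (hyz : G.Adj y z) (hd : degIn G S x ≤ 2 * k)
    (hco : #{w ∈ S | G.Adj w x ∧ G.Adj w y ∧ G.Adj w z} ≤ 1) :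
    score G S (k + 1) ≤ score G (S \ {x, y, z}) k + 2 := by
  have hT : ({x, y, z} : Finset V) ⊆ S := by
    intro w hw
    simp only [mem_insert, mem_singleton] at hw
    rcases hw with rfl | rfl | rfl <;> assumption
  have h1 : ∑ w ∈ S \ {x, y, z}, degSign (k + 1) (degIn G S w) ≤
      ∑ w ∈ S \ {x, y, z}, (degSign k (degIn G (S \ {x, y, z}) w) +
        if G.Adj w x ∧ G.Adj w y ∧ G.Adj w z then 1 else 0) := by
    refine sum_le_sum fun w hw => ?_
    have h1 := degIn_sdiff (G := G) (w := w) hT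
    rw [degIn_triple hxy.ne hxz.ne hyz.ne] at h1
    unfold degSign
    by_cases h2 : G.Adj w x <;> by_cases h3 : G.Adj w y <;> by_cases h4 : G.Adj w z <;>
      simp only [h2, h3, h4, if_true, if_false, and_self, and_true, and_false] at h1 ⊢ <;>
      omega
  have h2 : (∑ w ∈ S \ {x, y, z}, if G.Adj w x ∧ G.Adj w y ∧ G.Adj w z then 1 else 0 : ℤ) ≤
      #{w ∈ S | G.Adj w x ∧ G.Adj w y ∧ G.Adj w z} := by
    rw [card_filter]
    push_cast
    exact sum_le_sum_of_subset_of_nonneg sdiff_subset fun _ _ _ => by split_ifs <;> simp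
  have h3 : ∑ w ∈ {x, y, z}, degSign (k + 1) (degIn G S w) ≤ 1 := by
    rw [sum_insert (by simp [hxy.ne, hxz.ne]), sum_insert (by simp [hyz.ne]), sum_singleton,
      degSign_of_low (by omega)]
    have := @degSign_le_one (k + 1) (degIn G S y)
    have := @degSign_le_one (k + 1) (degIn G S z)
    omega
  rw [sum_add_distrib] at h1
  rw [score, score, ← sum_sdiff hT]
  have : (#{w ∈ S | G.Adj w x ∧ G.Adj w y ∧ G.Adj w z} : ℤ) ≤ 1 := by exact_mod_cast hco
  omega

end Score

section LowDegree

open scoped Classical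

variable {V : Type*} {G : SimpleGraph V} {A S : Finset V} {u v : V} {k : ℕ}

/-- Planar graphs of large score on fewer than `m` vertices contain disjoint cycles. -/
def PacksBelow (V : Type*) (m : ℕ) : Prop :=
  ∀ (G : SimpleGraph V) (S : Finset V) (k : ℕ), #S < m → 2 ≤ k → ParityPlanar G S →
    2 * k ≤ score G S k → Packs G S k

lemma PacksBelow.of_absorb (ih : PacksBelow V #S) (hk : 2 ≤ k) (h : ParityPlanar G S)
    (hs : 2 * k ≤ score G S k) (hu : u ∈ S) (hv : v ∈ S) (huv : G.Adj u v)
    (hd : 2 + codegIn G S u v ≤ degIn G S v) (hloss : degSign k (degIn G S v) +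
      #{w ∈ S | (G.Adj w u ∧ G.Adj w v) ∧ degIn G S w ≤ 2 * k} ≤ 0) : Packs G S k := by
  have := score_absorb (k := k) hu hv huv hd
  exact Packs.of_absorb huv hv
    (ih _ _ k (card_erase_lt_of_mem hv) hk (h.absorb huv hv) (by omega))

lemma PacksBelow.of_codegIn_eq_zero (ih : PacksBelow V #S) (hk : 2 ≤ k) (h : ParityPlanar G S)
    (hs : 2 * k ≤ score G S k) (hu : u ∈ S) (hv : v ∈ S) (huv : G.Adj u v)
    (hco : codegIn G S u v = 0) (hd : 2 ≤ degIn G S v) (hd' : degIn G S v < 2 * k) :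
    Packs G S k := by
  refine ih.of_absorb hk h hs hu hv huv (by omega) ?_
  have := card_filter_low_le_codegIn (G := G) (S := S) (u := u) (v := v) (k := k)
  have h0 : #{w ∈ S | (G.Adj w u ∧ G.Adj w v) ∧ degIn G S w ≤ 2 * k} = 0 := by omega
  rw [h0]
  unfold degSign
  omega

lemma PacksBelow.of_degIn_le_one (ih : PacksBelow V #S) (hk : 2 ≤ k) (h : ParityPlanar G S)
    (hs : 2 * k ≤ score G S k) (hv : v ∈ S) (hd : degIn G S v ≤ 1) : Packs G S k := by
  have := score_erase (G := G) (k := k) hv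
  rw [degSign_of_low (by omega)] at this
  exact (ih _ _ k (card_erase_lt_of_mem hv) hk (h.mono le_rfl (erase_subset _ _)) (by omega)).mono
    (erase_subset _ _)

lemma exists_common_of_codegIn_ne_zero (h : codegIn G A u v ≠ 0) :
    ∃ w ∈ A, G.Adj w u ∧ G.Adj w v := by
  obtain ⟨w, hw⟩ := card_pos.1 (Nat.pos_of_ne_zero h)
  exact ⟨w, (mem_filter.1 hw).1, (mem_filter.1 hw).2⟩

lemma PacksBelow.of_low (ih : PacksBelow V #S) (hk : 3 ≤ k) (h : ParityPlanar G S)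
    (hs : 2 * k ≤ score G S k) (hv : v ∈ S) (hd : degIn G S v + 2 ≤ 2 * k) : Packs G S k := by
  obtain hd1 | hd2 := Nat.lt_or_ge (degIn G S v) 2
  · exact ih.of_degIn_le_one (by omega) h hs hv (by omega)
  obtain ⟨u, hu, hvu⟩ := exists_adj_of_degIn_pos (show 0 < degIn G S v by omega)
  by_cases hco : codegIn G S u v = 0
  · exact ih.of_codegIn_eq_zero (by omega) h hs hu hv hvu.symm hco hd2 (by omega)
  obtain ⟨w, hw, hwu, hwv⟩ := exists_common_of_codegIn_ne_zero hco
  obtain ⟨z, hz, huz, hcoz⟩ := h.exists_codegIn_le_one (A := {w ∈ S | G.Adj v w}) hv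
    (filter_subset _ _) (fun a ha => (mem_filter.1 ha).2) (mem_filter.2 ⟨hu, hvu⟩)
    (degIn_pos (mem_filter.2 ⟨hw, hwv.symm⟩) hwu.symm)
  rw [mem_filter] at hz
  obtain ⟨k, rfl⟩ : ∃ l, k = l + 1 := ⟨k - 1, by omega⟩
  have := score_sdiff_triangle (k := k) hv hu hz.1 hvu hz.2 huz (by omega) (by
    rwa [codegIn, filter_filter, filter_congr fun w _ => by rw [G.adj_comm v w]] at hcoz)
  have hT : ({v, u, z} : Finset V) ⊆ S := by
    intro w hw
    simp only [mem_insert, mem_singleton] at hw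
    rcases hw with rfl | rfl | rfl
    exacts [hv, hu, hz.1]
  refine Packs.cons hT (hasCore_triangle hvu hz.2 huz)
    (ih _ _ k (card_lt_card (sdiff_ssubset hT ⟨v, by simp⟩)) (by omega)
      (h.mono le_rfl sdiff_subset) ?_)
  push_cast at hs
  omega

end LowDegree

section MinDegreeFive

open scoped Classical

variable {V : Type*} {G : SimpleGraph V} {A S : Finset V} {u v : V} {k : ℕ}

lemma triple_subset {x y z : V} (hx : x ∈ S) (hy : y ∈ S) (hz : z ∈ S) :
    ({x, y, z} : Finset V) ⊆ S := by
  simp [insert_subset_iff, hx, hy, hz]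

lemma hasCore_of_isNClique (h : G.IsNClique 3 A) : HasCore G A := by
  obtain ⟨x, y, z, hxy, hxz, hyz, rfl⟩ := SimpleGraph.is3Clique_iff.1 h
  exact hasCore_triangle hxy hxz hyz

/-- If every edge at a vertex of degree five lies in a triangle and there are many such vertices,
then there are two disjoint triangles. -/
lemma exists_disjoint_triangles (hcard : 12 ≤ #{v ∈ S | degIn G S v = 5})
    (htri : ∀ v ∈ S, degIn G S v = 5 → ∀ r ∈ S, G.Adj v r →
      ∃ p ∈ S, G.Adj p r ∧ G.Adj p v ∧ (degIn G S p ≤ 6 ∨ 4 ≤ codegIn G S r v)) :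
    ∃ T₁ ⊆ S, ∃ T₂ ⊆ S, Disjoint T₁ T₂ ∧ G.IsNClique 3 T₁ ∧ G.IsNClique 3 T₂ := by
  by_contra hno
  have hmeet : ∀ a ∈ S, ∀ b ∈ S, ∀ c ∈ S, ∀ x ∈ S, ∀ y ∈ S, ∀ z ∈ S, G.Adj a b → G.Adj a c →
      G.Adj b c → G.Adj x y → G.Adj x z → G.Adj y z → x ≠ a → x ≠ b → x ≠ c → y ≠ a → z ≠ a →
      y = b ∨ y = c ∨ z = b ∨ z = c := by
    intro a ha b hb c hc x hx y hy z hz h1 h2 h3 h4 h5 h6 h7 h8 h9 h10 h11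
    by_contra hcon
    push Not at hcon
    refine hno ⟨{a, b, c}, triple_subset ha hb hc, {x, y, z}, triple_subset hx hy hz, ?_,
      SimpleGraph.is3Clique_triple_iff.2 ⟨h1, h2, h3⟩,
      SimpleGraph.is3Clique_triple_iff.2 ⟨h4, h5, h6⟩⟩
    simp only [disjoint_insert_left, disjoint_singleton_left, mem_insert, mem_singleton]
    tauto
  obtain ⟨v, hv⟩ : ({v ∈ S | degIn G S v = 5} : Finset V).Nonempty := card_pos.1 (by omega)
  rw [mem_filter] at hv
  set N : Finset V := {w ∈ S | G.Adj v w} with hN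
  have hN5 : #N = 5 := hv.2
  have hmemN : ∀ x, x ∈ N ↔ x ∈ S ∧ G.Adj v x := fun x => by rw [hN, mem_filter]
  have hfar : 6 ≤ #(({v ∈ S | degIn G S v = 5} : Finset V) \ insert v N) := by
    have h1 := le_card_sdiff (insert v N) ({v ∈ S | degIn G S v = 5} : Finset V)
    have h2 := card_insert_le v N
    omega
  have hfar' : ∀ w ∈ ({v ∈ S | degIn G S v = 5} : Finset V) \ insert v N,
      w ∈ S ∧ degIn G S w = 5 ∧ w ≠ v ∧ w ∉ N ∧ ¬ G.Adj v w := by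
    intro w hw
    simp only [mem_sdiff, mem_filter, mem_insert, hmemN] at hw ⊢
    tauto
  -- No two disjoint edges in `N`.
  have hmatch : ∀ a ∈ N, ∀ b ∈ N, ∀ c ∈ N, ∀ d ∈ N, G.Adj a b → G.Adj c d →
      a ≠ c → a ≠ d → b ≠ c → b ≠ d → False := by
    intro a ha b hb c hc d hd hab hcd hac had hbc hbd
    obtain ⟨w, hw⟩ := card_pos.1 (show 0 < _ from lt_of_lt_of_le (by simp) hfar)
    obtain ⟨hwS, hw5, hwv, hwN, hvw⟩ := hfar' w hw
    have hsub : ({u ∈ S | G.Adj w u} : Finset V) ⊆ {a, b, c, d} := by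
      intro u hu
      rw [mem_filter] at hu
      obtain ⟨p, hp, hpu, hpw, -⟩ := htri w hwS hw5 u hu.1 hu.2
      have hne : ∀ x ∈ N, w ≠ x := fun x hx h => hwN (h ▸ hx)
      have h1 := hmeet v hv.1 a ((hmemN a).1 ha).1 b ((hmemN b).1 hb).1 w hwS u hu.1 p hp
        ((hmemN a).1 ha).2 ((hmemN b).1 hb).2 hab hu.2 hpw.symm hpu.symm hwv (hne a ha) (hne b hb)
        (by rintro rfl; exact hvw hu.2.symm) (by rintro rfl; exact hvw hpw)
      have h2 := hmeet v hv.1 c ((hmemN c).1 hc).1 d ((hmemN d).1 hd).1 w hwS u hu.1 p hp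
        ((hmemN c).1 hc).2 ((hmemN d).1 hd).2 hcd hu.2 hpw.symm hpu.symm hwv (hne c hc) (hne d hd)
        (by rintro rfl; exact hvw hu.2.symm) (by rintro rfl; exact hvw hpw)
      simp only [mem_insert, mem_singleton]
      grind
    have := (card_le_card hsub).trans card_le_four
    unfold degIn at hw5
    omega
  have hnbr : ∀ r ∈ N, ∃ p ∈ N, G.Adj r p := by
    intro r hr
    obtain ⟨p, hp, hpr, hpv, -⟩ := htri v hv.1 hv.2 r ((hmemN r).1 hr).1 ((hmemN r).1 hr).2
    exact ⟨p, (hmemN p).2 ⟨hp, hpv.symm⟩, hpr.symm⟩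
  -- Hence `N` spans a star, and its center has too many neighbours.
  have hstar : ∀ a ∈ N, ∀ b ∈ N, ∀ c ∈ N, G.Adj a b → c ≠ a → c ≠ b → G.Adj c a → False := by
    intro a ha b hb c hc hab hca hcb hadj
    obtain ⟨d, hd⟩ : (N \ {a, b, c}).Nonempty := by
      have h1 := le_card_sdiff ({a, b, c} : Finset V) N
      have h2 : #({a, b, c} : Finset V) ≤ 3 := card_le_three
      exact card_pos.1 (by omega)
    simp only [mem_sdiff, mem_insert, mem_singleton, not_or] at hd
    obtain ⟨hdN, hda, hdb, hdc⟩ := hd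
    have hdadj : G.Adj d a := by
      obtain ⟨y, hy, hdy⟩ := hnbr d hdN
      by_cases hya : y = a
      · rwa [← hya]
      by_cases hyb : y = b
      · subst hyb
        exact (hmatch d hdN y hy c hc a ha hdy hadj hdc hda hcb.symm hya).elim
      · exact (hmatch a ha b hb d hdN y hy hab hdy (Ne.symm hda) (Ne.symm hya) (Ne.symm hdb)
          (Ne.symm hyb)).elim
    have honly : ∀ p ∈ N, G.Adj p c → p = a := by
      intro p hp hpc
      by_contra hpa
      by_cases hpb : p = b
      · subst hpb
        exact hmatch p hp c hc d hdN a ha hpc hdadj (Ne.symm hdb) hpa (Ne.symm hdc) hca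
      · exact hmatch a ha b hb p hp c hc hab hpc (Ne.symm hpa) hca.symm (Ne.symm hpb) hcb.symm
    have hdeg : degIn G S a ≤ 6 := by
      obtain ⟨p, hp, hpc, hpv, h⟩ := htri v hv.1 hv.2 c ((hmemN c).1 hc).1 ((hmemN c).1 hc).2
      obtain rfl := honly p ((hmemN p).2 ⟨hp, hpv.symm⟩) hpc
      refine h.resolve_right fun h4 => ?_
      have : codegIn G S c v ≤ #({p} : Finset V) := card_le_card fun q hq => by
        rw [mem_filter] at hq
        exact mem_singleton.2 (honly q ((hmemN q).2 ⟨hq.1, hq.2.2.symm⟩) hq.2.1)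
      rw [card_singleton] at this
      omega
    have hsub : insert v (({v ∈ S | degIn G S v = 5} : Finset V) \ insert v N) ⊆
        ({w ∈ S | G.Adj a w} : Finset V) := by
      refine insert_subset (mem_filter.2 ⟨hv.1, ((hmemN a).1 ha).2.symm⟩) fun w hw => ?_
      obtain ⟨hwS, hw5, hwv, hwN, hvw⟩ := hfar' w hw
      refine mem_filter.2 ⟨hwS, ?_⟩
      have hwpos : 0 < degIn G S w := by omega
      obtain ⟨r, hr, hwr⟩ := exists_adj_of_degIn_pos hwpos
      obtain ⟨p, hp, hpr, hpw, -⟩ := htri w hwS hw5 r hr hwr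
      have hne : ∀ x ∈ N, w ≠ x := fun x hx h => hwN (h ▸ hx)
      have key : ∀ x ∈ N, G.Adj a x → r = a ∨ r = x ∨ p = a ∨ p = x := fun x hx hax =>
        hmeet v hv.1 a ((hmemN a).1 ha).1 x ((hmemN x).1 hx).1 w hwS r hr p hp
          ((hmemN a).1 ha).2 ((hmemN x).1 hx).2 hax hwr hpw.symm hpr.symm hwv (hne a ha) (hne x hx)
          (by rintro rfl; exact hvw hwr.symm) (by rintro rfl; exact hvw hpw)
      have h1 := key b hb hab
      have h2 := key c hc hadj.symm
      have h3 := key d hdN hdadj.symm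
      have : r = a ∨ p = a := by grind
      rcases this with rfl | rfl
      · exact hwr.symm
      · exact hpw
    have h1 := card_le_card hsub
    rw [card_insert_of_notMem (by simp)] at h1
    unfold degIn at hdeg
    omega
  obtain ⟨a, ha⟩ : N.Nonempty := card_pos.1 (by omega)
  obtain ⟨b, hb, hab⟩ := hnbr a ha
  obtain ⟨c, hc⟩ : (N \ {a, b}).Nonempty := by
    have h1 := le_card_sdiff ({a, b} : Finset V) N
    have h2 : #({a, b} : Finset V) ≤ 2 := card_le_two
    exact card_pos.1 (by omega)
  simp only [mem_sdiff, mem_insert, mem_singleton, not_or] at hc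
  obtain ⟨hcN, hca, hcb⟩ := hc
  obtain ⟨y, hy, hcy⟩ := hnbr c hcN
  by_cases hya : y = a
  · subst hya
    exact hstar y ha b hb c hcN hab hca hcb hcy
  by_cases hyb : y = b
  · subst hyb
    exact hstar y hb a ha c hcN hab.symm hcb hca hcy
  · exact hmatch a ha b hb c hcN y hy hab hcy (Ne.symm hca) (Ne.symm hya) (Ne.symm hcb)
      (Ne.symm hyb)

lemma ParityPlanar.packs_three_of_triangles (h : ParityPlanar G S) {T₁ T₂ : Finset V}
    (h1 : T₁ ⊆ S) (h2 : T₂ ⊆ S) (h12 : Disjoint T₁ T₂) (hT1 : G.IsNClique 3 T₁)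
    (hT2 : G.IsNClique 3 T₂) (hcard : 18 ≤ #S) (hd : ∀ v ∈ S, 5 ≤ degIn G S v) :
    Packs G S 3 := by
  have hX : T₁ ∪ T₂ ⊆ S := union_subset h1 h2
  by_cases hF : HasCore G (S \ (T₁ ∪ T₂))
  · refine Packs.cons h1 (hasCore_of_isNClique hT1) ?_
    refine packs_two (A := T₂) (B := S \ (T₁ ∪ T₂)) (subset_sdiff.2 ⟨h2, h12.symm⟩)
      (sdiff_subset_sdiff Subset.rfl subset_union_left) ?_ (hasCore_of_isNClique hT2) hF
    exact disjoint_sdiff.mono_left subset_union_right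
  · exfalso
    have hX6 : #(T₁ ∪ T₂) = 6 := by
      rw [card_union_of_disjoint h12, hT1.card_eq, hT2.card_eq]
    have hc := card_sdiff_add_card_eq_card hX
    have e1 := sum_degIn_of_not_hasCore hF (card_pos.1 (by omega))
    have e2 := h.sum_degIn_le (by omega)
    have e3 : #(S \ (T₁ ∪ T₂)) • 5 ≤ ∑ w ∈ S \ (T₁ ∪ T₂), degIn G S w :=
      card_nsmul_le_sum _ _ _ fun w hw => hd w (mem_sdiff.1 hw).1
    have e4 : ∑ w ∈ S \ (T₁ ∪ T₂), degIn G S w =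
        ∑ w ∈ S \ (T₁ ∪ T₂), degIn G (S \ (T₁ ∪ T₂)) w +
        ∑ w ∈ S \ (T₁ ∪ T₂), degIn G (T₁ ∪ T₂) w := by
      rw [← sum_add_distrib]
      exact sum_congr rfl fun w _ => degIn_sdiff hX
    have e5 : ∑ w ∈ S \ (T₁ ∪ T₂), degIn G (T₁ ∪ T₂) w ≤ ∑ w ∈ T₁ ∪ T₂, degIn G S w := by
      rw [sum_degIn_comm]
      exact sum_le_sum fun w _ => degIn_mono sdiff_subset
    have e6 := sum_sdiff (f := fun w => degIn G S w) hX
    rw [smul_eq_mul] at e3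
    omega

lemma PacksBelow.of_high (ih : PacksBelow V #S) (hk : 3 ≤ k) (h : ParityPlanar G S)
    (hs : 2 * k ≤ score G S k) (hd : ∀ v ∈ S, 2 * k ≤ degIn G S v + 1) : Packs G S k := by
  have hSk : 2 * k ≤ #S := by
    have : score G S k ≤ #S • 1 := sum_le_card_nsmul _ _ _ fun v _ => degSign_le_one
    rw [nsmul_one] at this
    omega
  have hE := h.sum_degIn_le (by omega)
  obtain rfl | hk4 := hk.eq_or_lt
  swap
  · have : #S • 7 ≤ ∑ v ∈ S, degIn G S v :=
      card_nsmul_le_sum _ _ _ fun v hv => by have := hd v hv; omega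
    rw [smul_eq_mul] at this
    omega
  have hM : (#{v ∈ S | degIn G S v = 5} : ℕ) = ∑ v ∈ S, if degIn G S v = 5 then 1 else 0 :=
    card_filter _ _
  have h12 : 12 ≤ #{v ∈ S | degIn G S v = 5} := by
    have : #S • 6 ≤ ∑ v ∈ S, (degIn G S v + if degIn G S v = 5 then 1 else 0) :=
      card_nsmul_le_sum _ _ _ fun v hv => by have := hd v hv; split_ifs <;> omega
    rw [sum_add_distrib, ← hM, smul_eq_mul] at this
    omega
  have h18 : 18 ≤ #S := by
    have : score G S 3 + #{v ∈ S | degIn G S v = 5} ≤ #S • 1 := by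
      rw [hM, score]
      push_cast
      rw [← sum_add_distrib]
      refine sum_le_card_nsmul _ _ _ fun v _ => ?_
      unfold degSign
      split_ifs <;> omega
    rw [nsmul_one] at this
    omega
  by_contra hno
  obtain ⟨T₁, h1, T₂, h2, hdis, hT1, hT2⟩ := exists_disjoint_triangles h12 (by
    intro v hv hv5 r hr hvr
    by_contra! hcon
    have hco : codegIn G S r v ≤ 3 := by
      by_contra! hco
      obtain ⟨p, hp, hpr, hpv⟩ := exists_common_of_codegIn_ne_zero (G := G) (A := S) (u := r)
        (v := v) (by omega)
      have := (hcon p hp hpr hpv).2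
      omega
    refine hno (ih.of_absorb (by omega) h hs hr hv hvr.symm (by omega) ?_)
    rw [hv5, filter_eq_empty_iff.2]
    · simp [degSign]
    · rintro w hw ⟨⟨h1, h2⟩, h3⟩
      have := (hcon w hw h1 h2).1
      omega)
  exact hno (h.packs_three_of_triangles h1 h2 hdis hT1 hT2 h18
    fun v hv => by have := hd v hv; omega)

end MinDegreeFive

section TwoCycles

open scoped Classical

variable {V : Type*} {G : SimpleGraph V} {A B F S : Finset V} {u v : V}

/-- Some nonempty subset of `A` spans minimum degree two once each vertex in `B` is given one
additional edge. -/
def Linked (G : SimpleGraph V) (B A : Finset V) : Prop :=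
  ∃ C ⊆ A, C.Nonempty ∧ ∀ v ∈ C, 2 ≤ degIn G C v + if v ∈ B then 1 else 0

lemma Linked.mono {A' : Finset V} (h : Linked G B A) (hA : A ⊆ A') : Linked G B A' := by
  obtain ⟨C, hC, h⟩ := h
  exact ⟨C, hC.trans hA, h⟩

lemma linked_pair (huv : G.Adj u v) (hu : u ∈ B) (hv : v ∈ B) : Linked G B {u, v} := by
  refine ⟨_, Subset.rfl, insert_nonempty _ _, fun w hw => ?_⟩
  simp only [mem_insert, mem_singleton] at hw
  rcases hw with rfl | rfl
  · rw [if_pos hu]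
    exact Nat.succ_le_succ (degIn_pos (mem_insert_of_mem (mem_singleton_self _)) huv)
  · rw [if_pos hv]
    exact Nat.succ_le_succ (degIn_pos (mem_insert_self _ _) huv.symm)

lemma Linked.of_insert_mark (h : Linked G (insert v B) A) (huA : u ∉ A) (hu : u ∈ B)
    (huv : G.Adj u v) : Linked G B (if v ∈ A then insert u A else A) := by
  obtain ⟨C, hC, hne, h⟩ := h
  by_cases hv : v ∈ C
  · rw [if_pos (hC hv)]
    refine ⟨insert u C, insert_subset_insert _ hC, insert_nonempty _ _, fun w hw => ?_⟩
    rw [degIn_insert fun h => huA (hC h)]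
    rcases mem_insert.1 hw with rfl | hw
    · have := degIn_pos hv huv
      simp only [hu, if_true]
      omega
    · have := h w hw
      by_cases hwv : w = v
      · subst hwv
        simp only [mem_insert_self, if_true, huv.symm] at this ⊢
        omega
      · simp only [mem_insert, or_iff_right hwv] at this
        omega
  · have : Linked G B A := ⟨C, hC, hne, fun w hw => by
      have hwv : w ≠ v := fun h => hv (h ▸ hw)
      simpa only [mem_insert, or_iff_right hwv] using h w hw⟩
    split_ifs
    · exact this.mono (subset_insert _ _)
    · exact this

lemma Linked.hasCore_insert (h : Linked G B A) (hv : v ∉ A) (hB : ∀ w ∈ B, G.Adj v w) :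
    HasCore G (insert v A) := by
  obtain ⟨C, hC, hne, h⟩ := h
  by_contra hc
  have hvC : v ∉ C := fun h => hv (hC h)
  have h1 : ¬ HasCore G (insert v C) := fun h => hc (h.mono (insert_subset_insert _ hC))
  have h2 := sum_degIn_of_not_hasCore h1 (insert_nonempty _ _)
  have h3 := sum_degIn_of_not_hasCore (fun h => h1 (h.mono (subset_insert _ _))) hne
  rw [sum_degIn_insert hvC, card_insert_of_notMem hvC] at h2
  have h4 : #C • 2 ≤ ∑ w ∈ C, (degIn G C w + if w ∈ B then 1 else 0) :=
    card_nsmul_le_sum _ _ _ h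
  have h5 : ∑ w ∈ C, (if w ∈ B then 1 else 0) ≤ degIn G C v := by
    rw [degIn_eq_sum]
    refine sum_le_sum fun w _ => ?_
    by_cases hw : w ∈ B
    · simp [hw, hB w hw]
    · simp [hw]
  rw [sum_add_distrib, smul_eq_mul] at h4
  omega

/-- In a forest without disjoint linked sets, the marked vertices raise the score by little. -/
lemma sum_degSign_le_one (hF : ¬ HasCore G F)
    (hlink : ∀ C ⊆ F, ∀ D ⊆ F, Disjoint C D → Linked G B C → ¬ Linked G B D) :
    ∑ z ∈ F, degSign 2 (degIn G F z + 1 + if z ∈ B then 1 else 0) ≤ 1 := by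
  induction hm : #F using Nat.strong_induction_on generalizing F B with
  | _ m ih =>
  subst hm
  rcases F.eq_empty_or_nonempty with rfl | hne
  · simp
  by_cases hsmall : ∃ u ∈ F, degIn G F u + (if u ∈ B then 1 else 0) ≤ 1
  · obtain ⟨u, hu, hd⟩ := hsmall
    have h1 := ih _ (card_erase_lt_of_mem hu) (fun h => hF (h.mono (erase_subset u F)))
      (fun C hC D hD => hlink C (hC.trans (erase_subset _ _)) D (hD.trans (erase_subset _ _))) rfl
    have h2 : ∑ z ∈ F.erase u, degSign 2 (degIn G F z + 1 + if z ∈ B then 1 else 0) ≤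
        ∑ z ∈ F.erase u, (degSign 2 (degIn G (F.erase u) z + 1 + if z ∈ B then 1 else 0) +
          if G.Adj u z then 1 else 0) := by
      refine sum_le_sum fun z _ => ?_
      rw [degIn_erase hu, add_right_comm _ _ 1, add_right_comm _ (ite _ _ _) (ite _ _ _)]
      refine degSign_add_le.trans_eq ?_
      simp [G.adj_comm]
    have h3 : (∑ z ∈ F.erase u, if G.Adj u z then 1 else 0 : ℤ) = degIn G F u := by
      rw [← degIn_erase_self, degIn_eq_sum]; simp
    rw [sum_add_distrib, h3] at h2
    rw [← add_sum_erase _ _ hu, degSign_of_low (by omega)]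
    omega
  push Not at hsmall
  obtain ⟨u, hu, hdu⟩ := exists_degIn_le_one hF Subset.rfl hne
  have hleaf : ∀ z ∈ F, degIn G F z ≤ 1 → z ∈ B ∧ degIn G F z = 1 := by
    intro z hz hd
    have := hsmall z hz
    split_ifs at this with h
    · exact ⟨h, by omega⟩
    · omega
  by_cases hmark : ∃ u ∈ F, degIn G F u ≤ 1 ∧ ∃ w ∈ F, G.Adj u w ∧ w ∉ B
  · obtain ⟨u, hu, hdu, w, hw, huw, hwB⟩ := hmark
    obtain ⟨huB, hdu1⟩ := hleaf u hu hdu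
    have huniq : ∀ z ∈ F, G.Adj u z → z = w := by
      intro z hz huz
      by_contra hzw
      have := two_le_degIn hz hw hzw huz huw
      omega
    have h1 := ih _ (card_erase_lt_of_mem hu) (B := insert w B)
      (fun h => hF (h.mono (erase_subset u F))) (by
        intro C hC D hD hCD hLC hLD
        have huC : u ∉ C := fun h => notMem_erase u F (hC h)
        have huD : u ∉ D := fun h => notMem_erase u F (hD h)
        refine hlink _ ?_ _ ?_ ?_ (hLC.of_insert_mark huC huB huw)
          (hLD.of_insert_mark huD huB huw)
        · split_ifs
          · exact insert_subset hu (hC.trans (erase_subset _ _))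
          · exact hC.trans (erase_subset _ _)
        · split_ifs
          · exact insert_subset hu (hD.trans (erase_subset _ _))
          · exact hD.trans (erase_subset _ _)
        · split_ifs with h1 h2 h2
          · exact absurd h2 (disjoint_left.1 hCD h1)
          · simp [hCD, huD]
          · simp [hCD, huC]
          · exact hCD) rfl
    have h2 : ∑ z ∈ F.erase u, degSign 2 (degIn G F z + 1 + if z ∈ B then 1 else 0) =
        ∑ z ∈ F.erase u, degSign 2 (degIn G (F.erase u) z + 1 +
          if z ∈ insert w B then 1 else 0) := by
      refine sum_congr rfl fun z hz => ?_
      congr 1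
      rw [degIn_erase hu]
      by_cases hzw : z = w
      · subst hzw
        simp [huw.symm, hwB]
      · have : ¬ G.Adj z u := fun h => hzw (huniq z (mem_of_mem_erase hz) h.symm)
        simp [this, hzw]
    rw [← add_sum_erase _ _ hu, h2, hdu1, if_pos huB]
    have : degSign 2 (1 + 1 + 1) = 0 := by simp [degSign]
    omega
  push Not at hmark
  obtain ⟨w, hw, huw⟩ := exists_adj_of_degIn_pos (show 0 < degIn G F u by
    have := (hleaf u hu hdu).2
    omega)
  have hstar : ∀ z ∈ F, z ≠ w → degIn G F z ≤ 1 → ∀ y ∈ F, G.Adj z y → y = w := by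
    intro z hz hzw hdz y hy hzy
    by_contra hyw
    by_cases hzu : z = u
    · subst hzu
      have := two_le_degIn hy hw hyw hzy huw
      omega
    have hyu : y ≠ u := by
      rintro rfl
      have := two_le_degIn hz hw hzw hzy.symm huw
      omega
    refine hlink {u, w} ?_ {z, y} ?_ ?_
      (linked_pair huw (hleaf u hu hdu).1 (hmark u hu hdu w hw huw))
      (linked_pair hzy (hleaf z hz hdz).1 (hmark z hz hdz y hy hzy))
    · simp [insert_subset_iff, hu, hw]
    · simp [insert_subset_iff, hz, hy]
    · simp only [disjoint_insert_left, disjoint_singleton_left, mem_insert, mem_singleton]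
      tauto
  have hall : ∀ z ∈ F, z ≠ w → degIn G F z ≤ 1 := by
    by_contra! hcon
    obtain ⟨q, hq, hqw, hdq⟩ := hcon
    set Q : Finset V := {z ∈ F | z ≠ w ∧ 2 ≤ degIn G F z} with hQ
    have hwQ : w ∉ Q := by simp [hQ]
    have hQne : Q.Nonempty := ⟨q, by simp [hQ, hq, hqw]; omega⟩
    have hQF : insert w Q ⊆ F := insert_subset hw (filter_subset _ _)
    have hdeg : ∀ p ∈ Q, 2 ≤ degIn G (insert w Q) p := by
      intro p hp
      rw [hQ, mem_filter] at hp
      refine hp.2.2.trans (card_le_card fun y hy => ?_)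
      rw [mem_filter] at hy
      refine mem_filter.2 ⟨?_, hy.2⟩
      rw [mem_insert, hQ, mem_filter]
      by_contra hcon
      push Not at hcon
      refine hp.2.1 (hstar y hy.1 hcon.1 ?_ p hp.1 hy.2.symm)
      have := hcon.2 hy.1 hcon.1
      omega
    have h1 := sum_degIn_of_not_hasCore (fun h => hF (h.mono hQF)) (insert_nonempty _ _)
    have h2 := sum_degIn_of_not_hasCore
      (fun h => hF (h.mono ((subset_insert _ _).trans hQF))) hQne
    have h3 : #Q • 2 ≤ ∑ p ∈ Q, degIn G (insert w Q) p := card_nsmul_le_sum _ _ _ hdeg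
    have h4 := sum_degIn_insert (G := G) hwQ
    have h5 := sum_insert (f := fun p => degIn G (insert w Q) p) hwQ
    have h6 : degIn G (insert w Q) w = degIn G Q w := by rw [degIn_insert hwQ]; simp
    rw [card_insert_of_notMem hwQ] at h1
    rw [smul_eq_mul] at h3
    omega
  have hrest : ∑ z ∈ F.erase w, degSign 2 (degIn G F z + 1 + if z ∈ B then 1 else 0) ≤ 0 := by
    refine sum_nonpos fun z hz => ?_
    have := hall z (mem_of_mem_erase hz) (ne_of_mem_erase hz)
    unfold degSign
    split_ifs <;> omega
  rw [← add_sum_erase _ _ hw]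
  have := @degSign_le_one 2 (degIn G F w + 1 + if w ∈ B then 1 else 0)
  omega

lemma packs_two_of_triangle {x y z : V} (hx : x ∈ S) (hy : y ∈ S) (hz : z ∈ S)
    (hxy : G.Adj x y) (hxz : G.Adj x z) (hyz : G.Adj y z) (h : HasCore G (S \ {x, y, z})) :
    Packs G S 2 :=
  packs_two (triple_subset hx hy hz) sdiff_subset disjoint_sdiff
    (hasCore_triangle hxy hxz hyz) h

/-- A vertex of degree at most three in a triangle. -/
lemma packs_two_of_low_triangle {a b : V} (hs : 4 ≤ score G S 2) (hv : v ∈ S) (ha : a ∈ S)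
    (hb : b ∈ S) (hva : G.Adj v a) (hvb : G.Adj v b) (hab : G.Adj a b) (hd : degIn G S v ≤ 3) :
    Packs G S 2 := by
  have hT : ({a, b} : Finset V) ⊆ S := by simp [insert_subset_iff, ha, hb]
  have hpair : ∀ z, degIn G {a, b} z =
      (if G.Adj z a then 1 else 0) + if G.Adj z b then 1 else 0 := fun z => by
    rw [degIn_eq_sum, sum_pair hab.ne]
  by_cases hF : HasCore G (S \ {a, b})
  · obtain ⟨C, hC, hne, hdeg⟩ := hF
    have hvC : v ∉ C := by
      intro hvC
      have h1 := hdeg v hvC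
      have h2 := degIn_mono (G := G) (v := v) hC
      have h3 := degIn_sdiff (G := G) (w := v) hT
      rw [hpair, if_pos hva, if_pos hvb] at h3
      omega
    refine packs_two_of_triangle hv ha hb hva hvb hab ⟨C, fun z hz => ?_, hne, hdeg⟩
    have := hC hz
    simp only [mem_sdiff, mem_insert, mem_singleton] at this ⊢
    refine ⟨this.1, ?_⟩
    rintro (rfl | h)
    · exact hvC hz
    · exact this.2 h
  set B : Finset V := {z ∈ S | G.Adj z a ∧ G.Adj z b} with hB
  by_contra hno
  have h1 : ∑ z ∈ S \ {a, b}, degSign 2 (degIn G (S \ {a, b}) z + 1 + if z ∈ B then 1 else 0)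
      ≤ 1 := by
    refine sum_degSign_le_one hF fun C hC D hD hCD hLC hLD => hno ?_
    have hmem : ∀ E ⊆ S \ {a, b}, a ∉ E ∧ b ∉ E ∧ E ⊆ S := by
      refine fun E hE => ⟨fun h => ?_, fun h => ?_, hE.trans sdiff_subset⟩
      · simpa using hE h
      · simpa using hE h
    obtain ⟨haC, hbC, hCS⟩ := hmem C hC
    obtain ⟨haD, hbD, hDS⟩ := hmem D hD
    refine packs_two (insert_subset ha hCS) (insert_subset hb hDS) ?_
      (hLC.hasCore_insert haC fun w hw => (mem_filter.1 hw).2.1.symm)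
      (hLD.hasCore_insert hbD fun w hw => (mem_filter.1 hw).2.2.symm)
    simp [hab.ne', haD, hbC, hCD]
  have h2 : ∑ z ∈ S \ {a, b}, degSign 2 (degIn G S z) ≤
      ∑ z ∈ S \ {a, b}, degSign 2 (degIn G (S \ {a, b}) z + 1 + if z ∈ B then 1 else 0) := by
    refine sum_le_sum fun z hz => degSign_mono ?_
    have hzB : z ∈ B ↔ G.Adj z a ∧ G.Adj z b := by
      rw [hB, mem_filter, and_iff_right (mem_sdiff.1 hz).1]
    rw [degIn_sdiff hT, hpair, if_congr hzB rfl rfl]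
    by_cases h1 : G.Adj z a <;> by_cases h2 : G.Adj z b <;> simp [h1, h2]
  rw [score, ← sum_sdiff hT, sum_pair hab.ne] at hs
  have := @degSign_le_one 2 (degIn G S a)
  have := @degSign_le_one 2 (degIn G S b)
  omega

lemma ParityPlanar.packs_two_of_high_triangle (h : ParityPlanar G S) {x y z : V} (hx : x ∈ S)
    (hy : y ∈ S) (hz : z ∈ S) (hxy : G.Adj x y) (hxz : G.Adj x z) (hyz : G.Adj y z)
    (hd : ∀ v ∈ S, 4 ≤ degIn G S v) : Packs G S 2 := by
  have hT := triple_subset hx hy hz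
  have hT3 : #({x, y, z} : Finset V) = 3 := card_eq_three.2 ⟨x, y, z, hxy.ne, hxz.ne, hyz.ne, rfl⟩
  have hcard := card_sdiff_add_card_eq_card hT
  have h5 : 5 ≤ #S := by
    have h1 := hd x hx
    have h2 : degIn G (S.erase x) x ≤ #(S.erase x) := degIn_le_card
    rw [degIn_erase_self, card_erase_of_mem hx] at h2
    omega
  have hE := h.sum_degIn_le (by omega)
  have hS4 : #S • 4 ≤ ∑ v ∈ S, degIn G S v := card_nsmul_le_sum _ _ _ hd
  by_contra hno
  have hF : ¬ HasCore G (S \ {x, y, z}) := fun h =>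
    hno (packs_two_of_triangle hx hy hz hxy hxz hyz h)
  obtain ⟨a, ha, hda⟩ := exists_degIn_le_one hF Subset.rfl (card_pos.1 (by omega))
  have haS := (mem_sdiff.1 ha).1
  have hsplit : ∀ w, degIn G S w = degIn G (S \ {x, y, z}) w + ((if G.Adj w x then 1 else 0) +
      (if G.Adj w y then 1 else 0) + if G.Adj w z then 1 else 0) := fun w => by
    rw [← degIn_triple hxy.ne hxz.ne hyz.ne]; exact degIn_sdiff hT
  have hadj : degIn G (S \ {x, y, z}) a = 1 ∧ G.Adj a x ∧ G.Adj a y ∧ G.Adj a z := by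
    have h1 := hd a haS
    rw [hsplit] at h1
    by_cases h2 : G.Adj a x <;> by_cases h3 : G.Adj a y <;> by_cases h4 : G.Adj a z <;>
      simp only [h2, h3, h4, if_true, if_false, and_true, and_false] at h1 ⊢ <;> omega
  obtain ⟨hda1, hax, hay, haz⟩ := hadj
  set F := (S \ {x, y, z}).erase a with hFdef
  have hFcard : #F + 1 = #(S \ {x, y, z}) := card_erase_add_one ha
  have hFS : ∀ w ∈ F, w ≠ a ∧ w ∈ S ∧ w ≠ x ∧ w ≠ y ∧ w ≠ z := by
    intro w hw
    simpa [hFdef] using hw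
  have key : ∀ p ∈ S, ∀ q ∈ S, ∀ r ∈ S, G.Adj q r → G.Adj a q → G.Adj a r → p ≠ q → p ≠ r →
      p ≠ a → p ∉ F → (∀ w ∈ F, w ≠ q ∧ w ≠ r) →
      ∑ w ∈ F, degIn G F w + 2 * degIn G F p ≤ 2 * #F := by
    intro p hp q hq r hr hqr haq har hpq hpr hpa hpF hqrF
    have h1 : ¬ HasCore G (insert p F) := by
      refine fun hc => hno (packs_two_of_triangle haS hq hr haq har hqr (hc.mono fun w hw => ?_))
      simp only [mem_sdiff, mem_insert, mem_singleton, not_or]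
      rcases mem_insert.1 hw with rfl | hw
      · exact ⟨hp, hpa, hpq, hpr⟩
      · exact ⟨(hFS w hw).2.1, (hFS w hw).1, hqrF w hw⟩
    have h2 := sum_degIn_of_not_hasCore h1 (insert_nonempty _ _)
    rw [sum_degIn_insert hpF, card_insert_of_notMem hpF] at h2
    omega
  have kx := key x hx y hy z hz hyz hay haz hxy.ne hxz.ne hax.ne' (fun hm => (hFS x hm).2.2.1 rfl)
    fun w hw => (hFS w hw).2.2.2
  have ky := key y hy x hx z hz hxz hax haz hxy.ne' hyz.ne hay.ne'
    (fun hm => (hFS y hm).2.2.2.1 rfl) fun w hw => ⟨(hFS w hw).2.2.1, (hFS w hw).2.2.2.2⟩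
  have kz := key z hz x hx y hy hxy hax hay hxz.ne' hyz.ne' haz.ne'
    (fun hm => (hFS z hm).2.2.2.2 rfl) fun w hw => ⟨(hFS w hw).2.2.1, (hFS w hw).2.2.2.1⟩
  have hsum : #F • 4 ≤ ∑ w ∈ F, (degIn G F w + (if G.Adj a w then 1 else 0) +
      ((if G.Adj x w then 1 else 0) + (if G.Adj y w then 1 else 0) +
        if G.Adj z w then 1 else 0)) := by
    refine card_nsmul_le_sum _ _ _ fun w hw => ?_
    have h1 := hd w (hFS w hw).2.1
    rw [hsplit, degIn_erase ha] at h1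
    simpa only [G.adj_comm] using h1
  have hFa : degIn G F a = 1 := by rw [hFdef, degIn_erase_self]; exact hda1
  simp only [sum_add_distrib, ← degIn_eq_sum, hFa, smul_eq_mul] at hsum hS4
  omega

lemma PacksBelow.packs_two (ih : PacksBelow V #S) (h : ParityPlanar G S)
    (hs : 4 ≤ score G S 2) : Packs G S 2 := by
  have hs' : 2 * ((2 : ℕ) : ℤ) ≤ score G S 2 := hs
  by_cases hlow : ∃ v ∈ S, degIn G S v ≤ 3
  · obtain ⟨v, hv, hd⟩ := hlow
    obtain hd1 | hd2 := Nat.lt_or_ge (degIn G S v) 2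
    · exact ih.of_degIn_le_one le_rfl h hs' hv (by omega)
    obtain ⟨u, hu, hvu⟩ := exists_adj_of_degIn_pos (show 0 < degIn G S v by omega)
    by_cases hco : codegIn G S u v = 0
    · exact ih.of_codegIn_eq_zero le_rfl h hs' hu hv hvu.symm hco hd2 (by omega)
    obtain ⟨w, hw, hwu, hwv⟩ := exists_common_of_codegIn_ne_zero hco
    exact packs_two_of_low_triangle hs hv hu hw hvu hwv.symm hwu.symm hd
  push Not at hlow
  obtain ⟨v, hv⟩ : S.Nonempty := by
    by_contra hne
    rw [not_nonempty_iff_eq_empty] at hne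
    simp [hne, score] at hs
  have hdv := hlow v hv
  obtain ⟨u, hu, hvu⟩ := exists_adj_of_degIn_pos (show 0 < degIn G S v by omega)
  by_cases hco : codegIn G S u v = 0
  · refine Packs.of_absorb hvu.symm hv
      (ih _ _ 2 (card_erase_lt_of_mem hv) le_rfl (h.absorb hvu.symm hv) ?_)
    have h1 : ∀ w ∈ S.erase v, 4 ≤ degIn (absorb G u v) (S.erase v) w := by
      intro w hw
      by_cases hwu : w = u
      · subst hwu
        have := degIn_absorb_self hu hv hvu.symm
        have := hlow w hu
        omega
      · have h1 := degIn_absorb hu hv hvu.symm hwu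
        have h2 := hlow w (mem_of_mem_erase hw)
        rw [if_neg] at h1
        · omega
        · exact fun h => (filter_eq_empty_iff.1 (card_eq_zero.1 hco)) (mem_of_mem_erase hw) h
    have h2 : #(S.erase v) • (1 : ℤ) ≤ score (absorb G u v) (S.erase v) 2 :=
      card_nsmul_le_sum _ _ _ fun w hw => by
        have := h1 w hw
        unfold degSign
        omega
    have h3 : degIn G (S.erase v) v ≤ #(S.erase v) := degIn_le_card
    rw [degIn_erase_self] at h3
    rw [nsmul_one] at h2
    omega
  · obtain ⟨w, hw, hwu, hwv⟩ := exists_common_of_codegIn_ne_zero hco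
    exact h.packs_two_of_high_triangle hv hu hw hvu hwv.symm hwu.symm hlow

end TwoCycles

lemma packsBelow (V : Type*) (m : ℕ) : PacksBelow V m := by
  induction m with
  | zero => exact fun G S k h => absurd h (Nat.not_lt_zero _)
  | succ m ih =>
    intro G S k hm hk h hs
    have ihS : PacksBelow V #S := fun G' S' k' h' => ih G' S' k' (by omega)
    obtain rfl | hk3 := hk.eq_or_lt
    · exact ihS.packs_two h hs
    by_cases hlow : ∃ v ∈ S, degIn G S v + 2 ≤ 2 * k
    · obtain ⟨v, hv, hd⟩ := hlow
      exact ihS.of_low hk3 h hs hv hd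
    · push Not at hlow
      exact ihS.of_high hk3 h hs fun v hv => by have := hlow v hv; omega

lemma card_Lset_add_score {V : Type*} [Fintype V] (G : SimpleGraph V) [DecidableRel G.Adj]
    {k : ℕ} (hk : 1 ≤ k) : #(Lset G k) + score G univ k = #(Hset G k) := by
  classical
  have hdeg : ∀ v, degIn G univ v = G.degree v := fun v => by
    rw [degIn, ← G.card_neighborFinset_eq_degree, G.neighborFinset_eq_filter]
    congr!
  rw [Lset, Hset, card_filter, card_filter, score]
  push_cast
  rw [← sum_add_distrib]
  refine sum_congr rfl fun v _ => ?_
  rw [hdeg, degSign]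
  split_ifs <;> omega

theorem planar_two_k {V : Type*} [Fintype V] (G : SimpleGraph V) [DecidableRel G.Adj]
    (k : ℕ) (hk : 2 ≤ k) (hplanar : IsPlanar G)
    (hHL : (Lset G k).card + 2 * k ≤ (Hset G k).card) :
    HasDisjointCycles G k := by
  have := card_Lset_add_score G (k := k) (by omega)
  exact (packsBelow V _ G univ k (Nat.lt_succ_self _) hk (parityPlanar_of_isPlanar hplanar _)
    (by omega)).hasDisjointCycles
end

section
/- Let k ≥ 2 be an integer, f : ℕ → ℤ a function, and let G be a finite simple graph without k pairwise vertex-disjoint cycles satisfying |H_k(G)| − |L_k(G)| ≥ f(k), which is minimal in the following sense: among all graphs without k disjoint cycles satisfying |H_k| − |L_k| ≥ f(k), G has the minimum number of vertices, and subject to that, the minimum number of edges. Then (1) the minimum degree δ(G) ≥ 2, and (2) for every edge uv of G, either the degree of u lies in {2k−1, 2k} or the degree of v lies in {2k−1, 2k}. -/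
open Finset

/-- A graph without `k` disjoint cycles satisfying `|H_k| - |L_k| ≥ f k`. -/
def IsCounterexample {V : Type} [Fintype V] (G : SimpleGraph V) [DecidableRel G.Adj]
    (k : ℕ) (f : ℕ → ℤ) : Prop :=
  ¬ HasDisjointCycles G k ∧ f k ≤ ((Hset G k).card : ℤ) - ((Lset G k).card : ℤ)

theorem HasDisjointCycles.map {V W : Type*} {G : SimpleGraph V} {H : SimpleGraph W} {k : ℕ}
    (φ : G →g H) (hφ : Function.Injective φ) (h : HasDisjointCycles G k) :
    HasDisjointCycles H k := by
  obtain ⟨v, c, hc, hd⟩ := h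
  refine ⟨fun i => φ (v i), fun i => (c i).map φ, fun i => (hc i).map hφ, ?_⟩
  intro i j hij x hxi hxj
  simp only [SimpleGraph.Walk.support_map, List.mem_map] at hxi hxj
  obtain ⟨a, ha, rfl⟩ := hxi
  obtain ⟨b, hb, hba⟩ := hxj
  exact hd i j hij a ha (hφ hba ▸ hb)

/-- The contribution of a vertex of degree `d` to `|H_k| - |L_k|`. -/
def degreeWeight (k d : ℕ) : ℤ :=
  (if 2 * k ≤ d then 1 else 0) - (if d ≤ 2 * k - 2 then 1 else 0)

theorem card_Hset_sub_card_Lset {V : Type*} [Fintype V] (G : SimpleGraph V)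
    [DecidableRel G.Adj] (k : ℕ) :
    ((Hset G k).card : ℤ) - ((Lset G k).card : ℤ) = ∑ v, degreeWeight k (G.degree v) := by
  simp [Hset, Lset, degreeWeight, Finset.sum_sub_distrib]

theorem degreeWeight_succ_le (k d : ℕ) (hk : 1 ≤ k) :
    degreeWeight k (d + 1) ≤ degreeWeight k d + 1 := by
  unfold degreeWeight
  split_ifs <;> omega

theorem degreeWeight_le_of_le_succ {k d e : ℕ} (hk : 1 ≤ k) (hle : e ≤ d) (hsucc : d ≤ e + 1)
    (h₁ : d ≠ 2 * k - 1) (h₂ : d ≠ 2 * k) : degreeWeight k d ≤ degreeWeight k e := by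
  unfold degreeWeight
  split_ifs <;> omega

theorem degree_eq_degree_comap_ne_add {V : Type*} [Fintype V] [DecidableEq V]
    (G : SimpleGraph V) [DecidableRel G.Adj] (v : V) (w : {x // x ≠ v}) :
    G.degree w = (G.comap (Subtype.val : {x // x ≠ v} → V)).degree w +
      if G.Adj v w then 1 else 0 := by
  have hmap : ((G.comap (Subtype.val : {x // x ≠ v} → V)).neighborFinset w).map
      (Function.Embedding.subtype _) = (G.neighborFinset w).erase v := by
    ext x
    simp [and_comm]
  rw [← SimpleGraph.card_neighborFinset_eq_degree, ← SimpleGraph.card_neighborFinset_eq_degree,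
    ← Finset.card_map (Function.Embedding.subtype _), hmap]
  split_ifs with h
  · rw [Finset.card_erase_add_one (by simpa using h.symm)]
  · rw [Finset.erase_eq_of_notMem (by simpa [G.adj_comm] using h), add_zero]

theorem sum_degreeWeight_le_comap {V : Type*} [Fintype V] [DecidableEq V] (G : SimpleGraph V)
    [DecidableRel G.Adj] {k : ℕ} (hk : 2 ≤ k) {v : V} (hv : G.degree v < 2) :
    ∑ w, degreeWeight k (G.degree w) ≤
      ∑ w, degreeWeight k ((G.comap (Subtype.val : {x // x ≠ v} → V)).degree w) := by
  have hweight : degreeWeight k (G.degree v) = -1 := by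
    unfold degreeWeight
    split_ifs <;> omega
  have hdeg : ∑ w : {x // x ≠ v}, (if G.Adj v w then 1 else 0 : ℤ) = G.degree v := by
    have h := Fintype.sum_eq_add_sum_subtype_ne (fun w => (if G.Adj v w then 1 else 0 : ℤ)) v
    simp only [SimpleGraph.irrefl, if_false, zero_add] at h
    rw [← h, ← SimpleGraph.card_neighborFinset_eq_degree, SimpleGraph.neighborFinset_eq_filter]
    simp
  have hle : ∀ w : {x // x ≠ v}, degreeWeight k (G.degree w) ≤
      degreeWeight k ((G.comap (Subtype.val : {x // x ≠ v} → V)).degree w) +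
        if G.Adj v w then 1 else 0 := by
    intro w
    rw [degree_eq_degree_comap_ne_add]
    split_ifs
    · exact degreeWeight_succ_le k _ (by omega)
    · simp
  have hsum := Finset.sum_le_sum fun w (_ : w ∈ univ) => hle w
  rw [Finset.sum_add_distrib, hdeg] at hsum
  rw [Fintype.sum_eq_add_sum_subtype_ne _ v, hweight]
  omega

theorem degree_le_degree_deleteEdges_add_one {V : Type*} [Fintype V] [DecidableEq V]
    (G : SimpleGraph V) [DecidableRel G.Adj] (u v w : V) :
    G.degree w ≤ (G.deleteEdges {s(u, v)}).degree w + 1 := by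
  have hsub : G.neighborFinset w ⊆
      insert (if w = u then v else u) ((G.deleteEdges {s(u, v)}).neighborFinset w) := by
    intro x hx
    simp only [SimpleGraph.mem_neighborFinset, Finset.mem_insert, SimpleGraph.deleteEdges_adj,
      Set.mem_singleton_iff, Sym2.eq_iff] at hx ⊢
    split_ifs <;> grind
  exact (Finset.card_le_card hsub).trans (Finset.card_insert_le _ _)

theorem degree_deleteEdges_of_ne {V : Type*} [Fintype V] [DecidableEq V]
    (G : SimpleGraph V) [DecidableRel G.Adj] {u v w : V} (hu : w ≠ u) (hv : w ≠ v) :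
    (G.deleteEdges {s(u, v)}).degree w = G.degree w := by
  rw [← SimpleGraph.card_neighborFinset_eq_degree, ← SimpleGraph.card_neighborFinset_eq_degree]
  congr 1
  ext x
  simp [hu, hv]

theorem minimal_counterexample_property {V : Type} [Fintype V] (G : SimpleGraph V)
    [DecidableRel G.Adj] (k : ℕ) (hk : 2 ≤ k) (f : ℕ → ℤ)
    (hG : IsCounterexample G k f)
    (hmin : ∀ (W : Type) [Fintype W] (H : SimpleGraph W) [DecidableRel H.Adj],
      IsCounterexample H k f →
        Fintype.card V < Fintype.card W ∨
        (Fintype.card V = Fintype.card W ∧ G.edgeFinset.card ≤ H.edgeFinset.card)) :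
    (∀ v : V, 2 ≤ G.degree v) ∧
    (∀ u v : V, G.Adj u v →
      G.degree u ∈ ({2 * k - 1, 2 * k} : Set ℕ) ∨ G.degree v ∈ ({2 * k - 1, 2 * k} : Set ℕ)) := by
  classical
  obtain ⟨hcyc, hf⟩ := hG
  rw [card_Hset_sub_card_Lset] at hf
  constructor
  · intro v
    by_contra! hv
    have hlt : Fintype.card {x // x ≠ v} < Fintype.card V :=
      Fintype.card_subtype_lt (x := v) (by simp)
    have hmin' := hmin {x // x ≠ v} (G.comap Subtype.val)
      ⟨fun h => hcyc (h.map (SimpleGraph.Embedding.comap (Function.Embedding.subtype _) G).toHom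
        Subtype.val_injective), by
        rw [card_Hset_sub_card_Lset]
        exact hf.trans (sum_degreeWeight_le_comap G hk hv)⟩
    omega
  · intro u v huv
    by_contra! hdeg
    simp only [Set.mem_insert_iff, Set.mem_singleton_iff, not_or] at hdeg
    obtain ⟨⟨hu₁, hu₂⟩, hv₁, hv₂⟩ := hdeg
    have hle : G.deleteEdges {s(u, v)} ≤ G := SimpleGraph.deleteEdges_le _
    have hweight : ∀ w, degreeWeight k (G.degree w) ≤
        degreeWeight k ((G.deleteEdges {s(u, v)}).degree w) := by
      intro w
      by_cases hw : w = u ∨ w = v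
      · apply degreeWeight_le_of_le_succ (by omega) (SimpleGraph.degree_le_of_le hle)
          (degree_le_degree_deleteEdges_add_one G u v w)
        · rcases hw with rfl | rfl <;> assumption
        · rcases hw with rfl | rfl <;> assumption
      · push Not at hw
        rw [degree_deleteEdges_of_ne G hw.1 hw.2]
    have hlt : (G.deleteEdges {s(u, v)}).edgeFinset.card < G.edgeFinset.card := by
      apply Finset.card_lt_card
      rw [SimpleGraph.edgeFinset_ssubset_edgeFinset]
      refine lt_of_le_of_ne hle fun h => ?_
      have hadj := huv
      rw [← h] at hadj
      simp at hadj
    have hmin' := hmin V (G.deleteEdges {s(u, v)})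
      ⟨fun h => hcyc (h.map (SimpleGraph.Hom.ofLE hle) Function.injective_id), by
        rw [card_Hset_sub_card_Lset]
        exact hf.trans (Finset.sum_le_sum fun w _ => hweight w)⟩
    omega
end
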